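/- arXiv:1903.04952 — 6 statements merged into one kernel-verified Lean document; each statement's English description precedes it below -/
import Mathlib

section
/- For all x, y ∈ ℝⁿ with |x|, |y| < R and x ≠ y, one has Φ_{n,s}(x,y)/|x−y|^{n−2s} ≥ (R^{n−2s}/s) · (R² − |x|²)^s (R² − |y|²)^s / (R² + |x||y|)^n. -/
open MeasureTheory

theorem integrableOn_rpow_mul_one_add_rpow {s : ℝ} (hs : 0 < s) {p : ℝ} (hp : p ≤ 0) (z : ℝ) :
    IntegrableOn (fun w : ℝ => w ^ (s - 1) * (1 + w) ^ p) (Set.Ioo 0 z) := by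
  have hint : IntegrableOn (fun w : ℝ => w ^ (s - 1)) (Set.Ioo 0 z) :=
    ((intervalIntegral.intervalIntegrable_rpow' (a := 0) (b := z) (by linarith)).1).mono_set
      Set.Ioo_subset_Ioc_self
  refine Integrable.mono' hint (by measurability) ?_
  refine (ae_restrict_iff' measurableSet_Ioo).2 (Filter.Eventually.of_forall fun w hw => ?_)
  have hw0 : 0 < w := hw.1
  rw [Real.norm_of_nonneg (by positivity)]
  exact mul_le_of_le_one_right (by positivity)
    (Real.rpow_le_one_of_one_le_of_nonpos (by linarith) hp)

/-- Bounding `(1 + w) ^ (-n / 2)` from below by its value at a point `q ^ 2 ≥ 1 + z`. -/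
theorem rpow_div_le_integral_rpow_mul_one_add_rpow {s : ℝ} (hs : 0 < s) (n : ℕ) {z q : ℝ}
    (hz : 0 ≤ z) (hq : 0 < q) (hzq : 1 + z ≤ q ^ 2) :
    z ^ s / s * (q ^ n)⁻¹ ≤
      ∫ w in Set.Ioo (0 : ℝ) z, w ^ (s - 1) * (1 + w) ^ (-(n : ℝ) / 2) := by
  have hn : -(n : ℝ) / 2 ≤ 0 := by linarith [n.cast_nonneg (α := ℝ)]
  have hval : ∫ w in Set.Ioo (0 : ℝ) z, w ^ (s - 1) * (q ^ n)⁻¹ = z ^ s / s * (q ^ n)⁻¹ := by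
    rw [integral_mul_const, ← integral_Ioc_eq_integral_Ioo,
      ← intervalIntegral.integral_of_le hz, integral_rpow (Or.inl (by linarith)),
      sub_add_cancel, Real.zero_rpow hs.ne', sub_zero]
  rw [← hval]
  refine setIntegral_mono_on ?_ (integrableOn_rpow_mul_one_add_rpow hs hn z)
    measurableSet_Ioo fun w hw => ?_
  · exact (((intervalIntegral.intervalIntegrable_rpow' (a := 0) (b := z)
      (by linarith)).1).mono_set Set.Ioo_subset_Ioc_self).mul_const _
  · have hw0 : 0 < w := hw.1
    have hqn : (q ^ n)⁻¹ = (q ^ 2) ^ (-(n : ℝ) / 2) := by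
      rw [← Real.rpow_natCast q 2, ← Real.rpow_mul hq.le, ← Real.rpow_natCast q n,
        ← Real.rpow_neg hq.le]
      congr 1
      push_cast
      ring
    rw [hqn]
    exact mul_le_mul_of_nonneg_left
      (Real.rpow_le_rpow_of_nonpos (by linarith) (by linarith [hw.2]) hn) (by positivity)

theorem sq_mul_norm_sub_sq_add_le {E : Type*} [NormedAddCommGroup E] [InnerProductSpace ℝ E]
    (R : ℝ) (x y : E) :
    R ^ 2 * ‖x - y‖ ^ 2 + (R ^ 2 - ‖x‖ ^ 2) * (R ^ 2 - ‖y‖ ^ 2) ≤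
      (R ^ 2 + ‖x‖ * ‖y‖) ^ 2 := by
  have hinner : -(‖x‖ * ‖y‖) ≤ inner ℝ x y := (abs_le.1 (abs_real_inner_le_norm x y)).1
  rw [norm_sub_sq_real]
  nlinarith [mul_le_mul_of_nonneg_left hinner (sq_nonneg R)]

/-- For all `x, y ∈ ℝⁿ` with `|x|, |y| < R` and `x ≠ y`, with
`ζ(x,y) = (R² − |x|²)(R² − |y|²)/(R²|x−y|²)` and `Φ(x,y) = ∫₀^ζ w^(s−1)(1+w)^(−n/2) dw`,
one has `Φ(x,y)/|x−y|^(n−2s) ≥ (R^(n−2s)/s) (R² − |x|²)^s (R² − |y|²)^s / (R² + |x||y|)^n`. -/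
theorem green_kernel_lower_bound (n : ℕ) (hn : 2 ≤ n) (s : ℝ) (hs : s ∈ Set.Ioo (0:ℝ) 1)
    (R : ℝ) (hR : 0 < R) (x y : EuclideanSpace ℝ (Fin n))
    (hx : ‖x‖ < R) (hy : ‖y‖ < R) (hxy : x ≠ y) :
    (∫ w in Set.Ioo (0:ℝ)
        ((R ^ 2 - ‖x‖ ^ 2) * (R ^ 2 - ‖y‖ ^ 2) / (R ^ 2 * ‖x - y‖ ^ 2)),
        w ^ (s - 1) * (1 + w) ^ (-(n : ℝ) / 2)) / ‖x - y‖ ^ ((n : ℝ) - 2 * s)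
      ≥ (R ^ ((n : ℝ) - 2 * s) / s) *
          ((R ^ 2 - ‖x‖ ^ 2) ^ s * (R ^ 2 - ‖y‖ ^ 2) ^ s / (R ^ 2 + ‖x‖ * ‖y‖) ^ n) := by
  have hs0 : 0 < s := hs.1
  have hd : 0 < ‖x - y‖ := norm_pos_iff.2 (sub_ne_zero.2 hxy)
  have ha : 0 < R ^ 2 - ‖x‖ ^ 2 := by nlinarith [norm_nonneg x]
  have hb : 0 < R ^ 2 - ‖y‖ ^ 2 := by nlinarith [norm_nonneg y]
  have hK : 0 < R ^ 2 + ‖x‖ * ‖y‖ := by positivity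
  have hkey := sq_mul_norm_sub_sq_add_le R x y
  set a := R ^ 2 - ‖x‖ ^ 2
  set b := R ^ 2 - ‖y‖ ^ 2
  set d := ‖x - y‖
  set K := R ^ 2 + ‖x‖ * ‖y‖
  have hzq : 1 + a * b / (R ^ 2 * d ^ 2) ≤ (K / (R * d)) ^ 2 := by
    rw [div_pow, mul_pow, one_add_div (by positivity)]
    gcongr
  have hmain := rpow_div_le_integral_rpow_mul_one_add_rpow hs0 n
    (by positivity : 0 ≤ a * b / (R ^ 2 * d ^ 2)) (by positivity : 0 < K / (R * d)) hzq
  rw [ge_iff_le, le_div_iff₀ (by positivity)]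
  refine le_of_eq_of_le ?_ hmain
  have hsq : ∀ t : ℝ, 0 < t → (t ^ 2) ^ s = t ^ (2 * s) := fun t ht => by
    rw [Real.rpow_mul ht.le, Real.rpow_two]
  rw [Real.div_rpow (by positivity) (by positivity), Real.mul_rpow ha.le hb.le,
    Real.mul_rpow (by positivity) (by positivity), hsq R hR, hsq d hd, Real.rpow_sub hR,
    Real.rpow_sub hd, Real.rpow_natCast, Real.rpow_natCast, div_pow, mul_pow]
  field_simp
end

section
/- For every q ∈ (0,1) and every x ∈ ℝⁿ with |x| < R, one has ∫_{B_{qR}(0)} G_{n,s}(x,y) dy ≥ (q^n (1−q²)^s / (1+q)^n) · (2s/n) · (Γ(n/2)/(2^{2s} Γ(n/2 + s) Γ(1 + s))) · (R² − |x|²)^s. -/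
open MeasureTheory

/-- The Green function `G_{n,s}` of the fractional Laplacian on the ball `B_R(0) ⊂ ℝⁿ`:
`G_{n,s}(x,y) = (Γ(n/2)/(2^(2s) π^(1/n) Γ(s)²)) · Φ_{n,s}(x,y)/|x−y|^(n−2s)` where
`Φ_{n,s}(x,y) = ∫₀^{ζ(x,y)} w^(s−1)(1+w)^(−n/2) dw` and
`ζ(x,y) = (R² − |x|²)(R² − |y|²)/(R²|x−y|²)`. -/
noncomputable def fracGreen (n : ℕ) (s R : ℝ) (x y : EuclideanSpace ℝ (Fin n)) : ℝ :=
  (Real.Gamma ((n : ℝ) / 2) / (2 ^ (2 * s) * Real.pi ^ (1 / (n : ℝ)) * Real.Gamma s ^ 2)) *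
    (∫ w in Set.Ioo (0:ℝ)
        ((R ^ 2 - ‖x‖ ^ 2) * (R ^ 2 - ‖y‖ ^ 2) / (R ^ 2 * ‖x - y‖ ^ 2)),
        w ^ (s - 1) * (1 + w) ^ (-(n : ℝ) / 2)) / ‖x - y‖ ^ ((n : ℝ) - 2 * s)

theorem gamma_one_add_mul_gamma_le {a s : ℝ} (ha : 1 ≤ a) (hs : 0 < s) :
    Real.Gamma (1 + s) * Real.Gamma a ≤ Real.Gamma (a + s) := by
  have hc := Real.convexOn_log_Gamma
  have h1 : (1:ℝ) ∈ Set.Ioi (0:ℝ) := by simp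
  have h2 : a + s ∈ Set.Ioi (0:ℝ) := by simp only [Set.mem_Ioi]; linarith
  have hd : 0 < a + s - 1 := by linarith
  have hu : 0 ≤ (a - 1) / (a + s - 1) := div_nonneg (by linarith) hd.le
  have hv : 0 ≤ s / (a + s - 1) := by positivity
  have k1 := hc.2 h1 h2 hu hv (by field_simp; ring)
  have k2 := hc.2 h1 h2 hv hu (by field_simp; ring)
  have e1 : ((a - 1) / (a + s - 1)) • (1:ℝ) + (s / (a + s - 1)) • (a + s) = 1 + s := by
    simp only [smul_eq_mul]; field_simp; ring
  have e2 : (s / (a + s - 1)) • (1:ℝ) + ((a - 1) / (a + s - 1)) • (a + s) = a := by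
    simp only [smul_eq_mul]; field_simp; ring
  rw [e1] at k1
  rw [e2] at k2
  simp only [Function.comp_apply, Real.Gamma_one, Real.log_one,
    smul_eq_mul] at k1 k2
  have e3 : s / (a + s - 1) * Real.log (Real.Gamma (a + s))
      + (a - 1) / (a + s - 1) * Real.log (Real.Gamma (a + s)) = Real.log (Real.Gamma (a + s)) := by
    field_simp; ring
  have p1 := Real.Gamma_pos_of_pos (show 0 < 1 + s by linarith)
  have p2 := Real.Gamma_pos_of_pos (show 0 < a by linarith)
  have p3 := Real.Gamma_pos_of_pos h2
  rw [← Real.log_le_log_iff (by positivity) p3, Real.log_mul p1.ne' p2.ne']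
  linarith

theorem integrableOn_Ioi_rpow_mul_one_add_rpow {s b : ℝ} (hs : 0 < s) (hb : b ≤ 0)
    (hsb : s + b < 0) :
    IntegrableOn (fun w : ℝ => w ^ (s - 1) * (1 + w) ^ b) (Set.Ioi 0) := by
  have hm : Measurable (fun w : ℝ => w ^ (s - 1) * (1 + w) ^ b) := by fun_prop
  rw [← Set.Ioc_union_Ioi_eq_Ioi (zero_le_one (α := ℝ))]
  refine IntegrableOn.union ?_ ?_
  · have h : IntegrableOn (fun w : ℝ => w ^ (s - 1)) (Set.Ioc 0 1) := by
      rw [← intervalIntegrable_iff_integrableOn_Ioc_of_le zero_le_one]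
      exact intervalIntegral.intervalIntegrable_rpow' (by linarith)
    refine Integrable.mono' h hm.aestronglyMeasurable ?_
    filter_upwards [ae_restrict_mem measurableSet_Ioc] with w hw
    have h0 : 0 < w := hw.1
    rw [Real.norm_of_nonneg (by positivity)]
    exact mul_le_of_le_one_right (by positivity)
      (Real.rpow_le_one_of_one_le_of_nonpos (by linarith) hb)
  · have h := integrableOn_Ioi_rpow_of_lt (a := s - 1 + b) (by linarith) zero_lt_one
    refine Integrable.mono' h hm.aestronglyMeasurable ?_
    filter_upwards [ae_restrict_mem measurableSet_Ioi] with w hw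
    have h0 : 0 < w := lt_trans zero_lt_one hw
    rw [Real.norm_of_nonneg (by positivity), Real.rpow_add h0]
    exact mul_le_mul_of_nonneg_left
      (Real.rpow_le_rpow_of_nonpos h0 (by linarith) hb) (by positivity)

theorem rpow_div_mul_one_add_rpow_le_setIntegral {s b ζ : ℝ} (hs : 0 < s) (hb : b ≤ 0)
    (hsb : s + b < 0) (hζ : 0 ≤ ζ) :
    ζ ^ s / s * (1 + ζ) ^ b ≤ ∫ w in Set.Ioo (0:ℝ) ζ, w ^ (s - 1) * (1 + w) ^ b := by
  have hi : IntervalIntegrable (fun w : ℝ => w ^ (s - 1)) volume 0 ζ :=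
    intervalIntegral.intervalIntegrable_rpow' (by linarith)
  have h1 : ∫ w in Set.Ioo (0:ℝ) ζ, w ^ (s - 1) * (1 + ζ) ^ b = ζ ^ s / s * (1 + ζ) ^ b := by
    rw [integral_mul_const, ← integral_Ioc_eq_integral_Ioo,
      ← intervalIntegral.integral_of_le hζ, integral_rpow (Or.inl (by linarith))]
    simp [Real.zero_rpow hs.ne']
  rw [← h1]
  refine setIntegral_mono_on ?_ ?_ measurableSet_Ioo ?_
  · exact (((intervalIntegrable_iff_integrableOn_Ioo_of_le hζ).1 hi).mul_const _)
  · exact (integrableOn_Ioi_rpow_mul_one_add_rpow hs hb hsb).mono_set Set.Ioo_subset_Ioi_self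
  · intro w hw
    have h0 : 0 < w := hw.1
    have h2 : w < ζ := hw.2
    exact mul_le_mul_of_nonneg_left
      (Real.rpow_le_rpow_of_nonpos (by linarith) (by linarith) hb) (by positivity)

theorem integrableOn_ball_norm_sub_rpow {E : Type*} [NormedAddCommGroup E] [NormedSpace ℝ E]
    [FiniteDimensional ℝ E] [MeasurableSpace E] [BorelSpace E] (μ : Measure E)
    [μ.IsAddHaarMeasure] (hd : 1 ≤ Module.finrank ℝ E) {α : ℝ}
    (hα : α < Module.finrank ℝ E) (x : E) (r : ℝ) :
    IntegrableOn (fun y => ‖x - y‖ ^ (-α)) (Metric.ball 0 r) μ := by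
  have h : IntegrableOn (fun z : E => ‖z‖ ^ (-α)) (Metric.ball 0 (‖x‖ + r)) μ := by
    refine integrableOn_ball_of_norm_le_rpow (C := 1) hd hα ?_ ?_
    · refine Filter.Eventually.of_forall fun z => ?_
      rw [Real.norm_of_nonneg (by positivity), one_mul]
    · exact (by fun_prop : Measurable fun z : E => ‖z‖ ^ (-α)).aestronglyMeasurable
  rw [← integrable_indicator_iff measurableSet_ball] at h
  refine ((h.comp_sub_left x).integrableOn (s := Metric.ball 0 r)).congr_fun ?_ measurableSet_ball
  intro y hy
  refine Set.indicator_of_mem ?_ _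
  rw [mem_ball_zero_iff] at hy ⊢
  linarith [norm_sub_le x y]

theorem le_fracGreen {n : ℕ} (hn : 2 ≤ n) {s : ℝ} (hs : s ∈ Set.Ioo (0:ℝ) 1) {R : ℝ} (hR : 0 < R)
    {q : ℝ} (hq : q ∈ Set.Ioo (0:ℝ) 1) {x y : EuclideanSpace ℝ (Fin n)} (hx : ‖x‖ < R)
    (hy : ‖y‖ < q * R) (hxy : x ≠ y) :
    (Real.Gamma ((n : ℝ) / 2) / (2 ^ (2 * s) * Real.pi ^ (1 / (n : ℝ)) * Real.Gamma s ^ 2)) *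
      ((R ^ 2 - ‖x‖ ^ 2) ^ s * (1 - q ^ 2) ^ s / (s * (R * (1 + q)) ^ n)) ≤
    fracGreen n s R x y := by
  obtain ⟨hs0, hs1⟩ := hs
  obtain ⟨hq0, hq1⟩ := hq
  have hn' : (2:ℝ) ≤ n := by exact_mod_cast hn
  have hd : 0 < ‖x - y‖ := norm_pos_iff.2 (sub_ne_zero.2 hxy)
  set d := ‖x - y‖ with hd_def
  have hA : 0 < R ^ 2 - ‖x‖ ^ 2 := by nlinarith [norm_nonneg x]
  have hB : R ^ 2 * (1 - q ^ 2) ≤ R ^ 2 - ‖y‖ ^ 2 := by nlinarith [norm_nonneg y]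
  have hq2 : 0 < 1 - q ^ 2 := by nlinarith
  have hkey := sq_mul_norm_sub_sq_add_le R x y
  have hxy' : ‖x‖ * ‖y‖ ≤ R * (q * R) :=
    mul_le_mul hx.le hy.le (norm_nonneg y) hR.le
  have hle : (R ^ 2 + ‖x‖ * ‖y‖) ^ 2 ≤ (R ^ 2 + R * (q * R)) ^ 2 := by gcongr
  have hΓ : 0 < Real.Gamma ((n : ℝ) / 2) := Real.Gamma_pos_of_pos (by linarith)
  have hΓs : 0 < Real.Gamma s := Real.Gamma_pos_of_pos hs0
  rw [fracGreen, mul_div_assoc (_ / _), ← hd_def]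
  rw [← hd_def] at hkey
  generalize R ^ 2 - ‖x‖ ^ 2 = A at *
  generalize R ^ 2 - ‖y‖ ^ 2 = B at *
  have hB0 : 0 < B := lt_of_lt_of_le (by positivity) hB
  have hc : 0 ≤ Real.Gamma ((n : ℝ) / 2) /
      (2 ^ (2 * s) * Real.pi ^ (1 / (n : ℝ)) * Real.Gamma s ^ 2) := by positivity
  refine mul_le_mul_of_nonneg_left ?_ hc
  rw [le_div_iff₀ (Real.rpow_pos_of_pos hd _)]
  have hζ : 0 < A * B / (R ^ 2 * d ^ 2) := by positivity
  refine le_trans ?_ (rpow_div_mul_one_add_rpow_le_setIntegral hs0 (b := -(n:ℝ) / 2)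
    (by linarith) (by linarith) hζ.le)
  have hζ1 : A * (1 - q ^ 2) / d ^ 2 ≤ A * B / (R ^ 2 * d ^ 2) := by
    rw [div_le_div_iff₀ (by positivity) (by positivity)]
    calc _ = A * d ^ 2 * (R ^ 2 * (1 - q ^ 2)) := by ring
      _ ≤ A * d ^ 2 * B := by gcongr
      _ = _ := by ring
  have hζ2 : 1 + A * B / (R ^ 2 * d ^ 2) ≤ (R * (1 + q) / d) ^ 2 := by
    rw [div_pow, ← sub_nonneg]
    have : (R * (1 + q)) ^ 2 / d ^ 2 - (1 + A * B / (R ^ 2 * d ^ 2)) =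
        ((R ^ 2 + R * (q * R)) ^ 2 - (R ^ 2 * d ^ 2 + A * B)) / (R ^ 2 * d ^ 2) := by
      field_simp
    rw [this]
    exact div_nonneg (by linarith) (by positivity)
  have hp1 : (A * (1 - q ^ 2) / d ^ 2) ^ s ≤ (A * B / (R ^ 2 * d ^ 2)) ^ s :=
    Real.rpow_le_rpow (by positivity) hζ1 hs0.le
  have hp2 : ((R * (1 + q) / d) ^ 2) ^ (-(n:ℝ) / 2) ≤
      (1 + A * B / (R ^ 2 * d ^ 2)) ^ (-(n:ℝ) / 2) :=
    Real.rpow_le_rpow_of_nonpos (by positivity) hζ2 (by linarith)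
  have e1 : (A * (1 - q ^ 2) / d ^ 2) ^ s = A ^ s * (1 - q ^ 2) ^ s / d ^ (2 * s) := by
    rw [Real.div_rpow (by positivity) (by positivity), Real.mul_rpow hA.le hq2.le,
      Real.rpow_mul hd.le, Real.rpow_two]
  have e2 : ((R * (1 + q) / d) ^ 2) ^ (-(n:ℝ) / 2) = d ^ n / (R * (1 + q)) ^ n := by
    rw [← Real.rpow_two, ← Real.rpow_mul (by positivity),
      show 2 * (-(n:ℝ) / 2) = -n by ring, Real.rpow_neg (by positivity), Real.rpow_natCast,
      div_pow, inv_div]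
  rw [e1] at hp1
  rw [e2] at hp2
  calc _ = A ^ s * (1 - q ^ 2) ^ s / d ^ (2 * s) / s * (d ^ n / (R * (1 + q)) ^ n) := by
        rw [Real.rpow_sub hd, Real.rpow_natCast]; field_simp
    _ ≤ _ := by gcongr

theorem integrableOn_fracGreen {n : ℕ} (hn : 2 ≤ n) {s : ℝ} (hs : s ∈ Set.Ioo (0:ℝ) 1) (R : ℝ)
    (x : EuclideanSpace ℝ (Fin n)) (r : ℝ) :
    IntegrableOn (fracGreen n s R x) (Metric.ball 0 r) := by
  obtain ⟨hs0, hs1⟩ := hs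
  have hn' : (2:ℝ) ≤ n := by exact_mod_cast hn
  set f : ℝ → ℝ := fun w => w ^ (s - 1) * (1 + w) ^ (-(n : ℝ) / 2) with hf
  have hint : IntegrableOn f (Set.Ioi 0) :=
    integrableOn_Ioi_rpow_mul_one_add_rpow hs0 (by linarith) (by linarith)
  have hf0 : 0 ≤ᵐ[volume.restrict (Set.Ioi 0)] f := by
    filter_upwards [ae_restrict_mem measurableSet_Ioi] with w hw
    have : 0 < w := hw
    simp only [hf, Pi.zero_apply]
    positivity
  set Φ : ℝ → ℝ := fun ζ => ∫ w in Set.Ioo (0:ℝ) ζ, f w with hΦ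
  have hΦ_mono : Monotone Φ := by
    intro a b hab
    refine setIntegral_mono_set (hint.mono_set Set.Ioo_subset_Ioi_self)
      (ae_restrict_of_ae_restrict_of_subset Set.Ioo_subset_Ioi_self hf0)
      (Set.Ioo_subset_Ioo_right hab).eventuallyLE
  have hΦ_le (ζ : ℝ) : Φ ζ ≤ ∫ w in Set.Ioi (0:ℝ), f w :=
    setIntegral_mono_set hint hf0 Set.Ioo_subset_Ioi_self.eventuallyLE
  have hΦ_nonneg (ζ : ℝ) : 0 ≤ Φ ζ :=
    integral_nonneg_of_ae
      (ae_restrict_of_ae_restrict_of_subset Set.Ioo_subset_Ioi_self hf0)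
  set c := Real.Gamma ((n : ℝ) / 2) / (2 ^ (2 * s) * Real.pi ^ (1 / (n : ℝ)) * Real.Gamma s ^ 2)
    with hc
  have hc0 : 0 ≤ c := by
    have : 0 < Real.Gamma ((n : ℝ) / 2) := Real.Gamma_pos_of_pos (by linarith)
    positivity
  have heq : fracGreen n s R x = fun y => c *
      Φ ((R ^ 2 - ‖x‖ ^ 2) * (R ^ 2 - ‖y‖ ^ 2) / (R ^ 2 * ‖x - y‖ ^ 2)) /
        ‖x - y‖ ^ ((n : ℝ) - 2 * s) := rfl
  have hbound := (integrableOn_ball_norm_sub_rpow (volume : Measure (EuclideanSpace ℝ (Fin n)))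
    (α := (n : ℝ) - 2 * s) (by simp; omega) (by simp [hs0]) x r).const_mul
      (c * ∫ w in Set.Ioi (0:ℝ), f w)
  refine Integrable.mono' hbound ?_ (Filter.Eventually.of_forall fun y => ?_)
  · have hΦm := hΦ_mono.measurable
    rw [heq]
    exact (((hΦm.comp (by fun_prop)).const_mul c).div (by fun_prop)).aestronglyMeasurable
  · have h0 := hΦ_nonneg ((R ^ 2 - ‖x‖ ^ 2) * (R ^ 2 - ‖y‖ ^ 2) / (R ^ 2 * ‖x - y‖ ^ 2))
    simp only [heq]
    rw [Real.norm_of_nonneg (by positivity), Real.rpow_neg (norm_nonneg _), div_eq_mul_inv]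
    gcongr
    exact hΦ_le _

theorem volume_real_ball_eq {n : ℕ} (hn : n ≠ 0) (x : EuclideanSpace ℝ (Fin n)) {r : ℝ}
    (hr : 0 ≤ r) :
    volume.real (Metric.ball x r) =
      r ^ n * (√Real.pi ^ n / ((n : ℝ) / 2 * Real.Gamma ((n : ℝ) / 2))) := by
  have : Nonempty (Fin n) := Fin.pos_iff_nonempty.1 (Nat.pos_of_ne_zero hn)
  have hn0 : (0:ℝ) < n := by exact_mod_cast Nat.pos_of_ne_zero hn
  have hΓ : 0 < Real.Gamma ((n : ℝ) / 2) := Real.Gamma_pos_of_pos (by positivity)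
  rw [measureReal_def, EuclideanSpace.volume_ball, Fintype.card_fin,
    Real.Gamma_add_one (by positivity), ENNReal.toReal_mul, ENNReal.toReal_pow,
    ENNReal.toReal_ofReal hr, ENNReal.toReal_ofReal (by positivity)]

/-- For every `q ∈ (0,1)` and every `x ∈ ℝⁿ` with `|x| < R`,
`∫_{B_{qR}(0)} G_{n,s}(x,y) dy ≥ (q^n (1−q²)^s / (1+q)^n) · (2s/n) ·
(Γ(n/2)/(2^(2s) Γ(n/2 + s) Γ(1 + s))) · (R² − |x|²)^s`. -/
theorem green_ball_integral_lower_bound (n : ℕ) (hn : 2 ≤ n) (s : ℝ)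
    (hs : s ∈ Set.Ioo (0:ℝ) 1) (R : ℝ) (hR : 0 < R) (q : ℝ) (hq : q ∈ Set.Ioo (0:ℝ) 1)
    (x : EuclideanSpace ℝ (Fin n)) (hx : ‖x‖ < R) :
    (∫ y in Metric.ball (0 : EuclideanSpace ℝ (Fin n)) (q * R), fracGreen n s R x y)
      ≥ (q ^ n * (1 - q ^ 2) ^ s / (1 + q) ^ n) * (2 * s / (n : ℝ)) *
          (Real.Gamma ((n : ℝ) / 2) /
            (2 ^ (2 * s) * Real.Gamma ((n : ℝ) / 2 + s) * Real.Gamma (1 + s))) *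
          (R ^ 2 - ‖x‖ ^ 2) ^ s := by
  have hn0 : n ≠ 0 := by omega
  have hn' : (2:ℝ) ≤ n := by exact_mod_cast hn
  have : Nonempty (Fin n) := Fin.pos_iff_nonempty.1 (by omega)
  have hmono := setIntegral_mono_on_ae (μ := volume)
    (integrableOn_const (C := Real.Gamma ((n : ℝ) / 2) /
      (2 ^ (2 * s) * Real.pi ^ (1 / (n : ℝ)) * Real.Gamma s ^ 2) *
        ((R ^ 2 - ‖x‖ ^ 2) ^ s * (1 - q ^ 2) ^ s / (s * (R * (1 + q)) ^ n))) (s := Metric.ball (0 : EuclideanSpace ℝ (Fin n)) (q * R))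
      measure_ball_lt_top.ne) (integrableOn_fracGreen hn hs R x (q * R)) measurableSet_ball
      (by
        filter_upwards [Measure.ae_ne volume x] with y hy hmem
        exact le_fracGreen hn hs hR hq hx (mem_ball_zero_iff.1 hmem) hy.symm)
  rw [setIntegral_const, volume_real_ball_eq hn0 _ (mul_nonneg hq.1.le hR.le), smul_eq_mul] at hmono
  refine le_trans ?_ hmono
  obtain ⟨hs0, hs1⟩ := hs
  obtain ⟨hq0, hq1⟩ := hq
  have hA : 0 < R ^ 2 - ‖x‖ ^ 2 := by nlinarith [norm_nonneg x]
  have hq2 : 0 < 1 - q ^ 2 := by nlinarith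
  have hΓ : 0 < Real.Gamma ((n : ℝ) / 2) := Real.Gamma_pos_of_pos (by linarith)
  have hΓ' : 0 < Real.Gamma ((n : ℝ) / 2 + s) := Real.Gamma_pos_of_pos (by linarith)
  have hΓs : 0 < Real.Gamma s := Real.Gamma_pos_of_pos hs0
  have hgam := gamma_one_add_mul_gamma_le (a := (n : ℝ) / 2) (by linarith) hs0
  have hpi : Real.pi ^ (1 / (n : ℝ)) ≤ √Real.pi ^ n := by
    rw [Real.sqrt_eq_rpow, ← Real.rpow_natCast, ← Real.rpow_mul Real.pi_pos.le]
    refine Real.rpow_le_rpow_of_exponent_le (by linarith [Real.two_le_pi]) ?_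
    rw [div_le_iff₀ (by linarith)]
    nlinarith
  rw [add_comm 1 s, Real.Gamma_add_one hs0.ne'] at hgam ⊢
  have hp : 0 < Real.pi ^ (1 / (n : ℝ)) := by positivity
  generalize Real.pi ^ (1 / (n : ℝ)) = p at *
  generalize √Real.pi ^ n = P at *
  generalize (R ^ 2 - ‖x‖ ^ 2) = A at *
  generalize (1 - q ^ 2) = Q at *
  generalize Real.Gamma ((n : ℝ) / 2) = g at *
  generalize Real.Gamma ((n : ℝ) / 2 + s) = g' at *
  generalize Real.Gamma s = γ at *
  have hprod : s * γ * g * p ≤ g' * P := mul_le_mul hgam hpi hp.le hΓ'.le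
  have hfrac : g / (g' * γ) ≤ P / (p * s * γ ^ 2) := by
    rw [div_le_div_iff₀ (by positivity) (by positivity)]
    nlinarith [mul_le_mul_of_nonneg_left hprod hΓs.le]
  calc _ = (q ^ n * Q ^ s / (1 + q) ^ n * (2 / n) / 2 ^ (2 * s) * A ^ s) * (g / (g' * γ)) := by
        field_simp
    _ ≤ (q ^ n * Q ^ s / (1 + q) ^ n * (2 / n) / 2 ^ (2 * s) * A ^ s) * (P / (p * s * γ ^ 2)) := by
        gcongr
    _ = _ := by
        rw [mul_pow, mul_pow]; field_simp
end

section
/- Let F₁, F₂ > 0, n ≥ 2 an integer, and q, s ∈ (0,1) satisfy (F₁ + F₂)/F₂ ≥ (n/(2s)) · (1+q)^n / ((1−q²)^s q^n). Then for every R > 0, setting r₀ := qR, the function u(x) := F₂ ∫_{B_R(0)} G_{n,s}(x,y) dy − (F₁ + F₂) ∫_{B_{r₀}(0)} G_{n,s}(x,y) dy is radial and radially nondecreasing on B_R(0): for all x₁, x₂ ∈ ℝⁿ with |x₁| ≤ |x₂| < R one has u(x₁) ≤ u(x₂). -/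
open MeasureTheory

section Sphere

open Set Metric
open scoped ENNReal

theorem lintegral_eq_lintegral_toSphere_Ioi {E : Type*} [NormedAddCommGroup E] [NormedSpace ℝ E]
    [MeasurableSpace E] [BorelSpace E] [FiniteDimensional ℝ E] [Nontrivial E]
    (μ : Measure E) [μ.IsAddHaarMeasure] {f : E → ℝ≥0∞} (hf : Measurable f) :
    ∫⁻ y, f y ∂μ = ∫⁻ σ : sphere (0 : E) 1, (∫⁻ ρ in Ioi (0 : ℝ),
      ENNReal.ofReal (ρ ^ (Module.finrank ℝ E - 1)) * f (ρ • (σ : E))) ∂μ.toSphere := by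
  have h1 : ∫⁻ y, f y ∂μ = ∫⁻ y : ({(0 : E)}ᶜ : Set E), f y.1 ∂(μ.comap (↑)) := by
    rw [lintegral_subtype_comap (measurableSet_singleton _).compl, restrict_compl_singleton]
  have h2 := (μ.measurePreserving_homeomorphUnitSphereProd).symm
    (homeomorphUnitSphereProd E).toMeasurableEquiv
  have hm : Measurable fun y : ({(0 : E)}ᶜ : Set E) => f y.1 := hf.comp measurable_subtype_coe
  have h3 := h2.lintegral_comp hm
  rw [h1, ← h3, lintegral_prod]
  · refine lintegral_congr fun σ => ?_
    rw [Measure.volumeIoiPow, lintegral_withDensity_eq_lintegral_mul]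
    · rw [← lintegral_subtype_comap measurableSet_Ioi]
      refine lintegral_congr fun ρ => ?_
      simp [Homeomorph.toMeasurableEquiv]
    · exact (measurable_subtype_coe.pow_const _).ennreal_ofReal
    · exact hm.comp (((homeomorphUnitSphereProd E).symm.measurable).comp measurable_prodMk_left)
  · exact (hm.comp ((homeomorphUnitSphereProd E).symm.measurable)).aemeasurable

theorem lintegral_ray_eq (r c : ℝ) (hr : 0 ≤ r) (g : ℝ → ℝ≥0∞) :
    ∫⁻ t in Ioi (0 : ℝ), ENNReal.ofReal t⁻¹ *
        (Ioi r).indicator g (√(t ^ 2 + 2 * c * t + r ^ 2)) =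
      ∫⁻ ρ in Ioi r, ENNReal.ofReal
        (ρ / √(c ^ 2 + ρ ^ 2 - r ^ 2) / (-c + √(c ^ 2 + ρ ^ 2 - r ^ 2))) * g ρ := by
  set f : ℝ → ℝ := fun ρ => -c + √(c ^ 2 + ρ ^ 2 - r ^ 2) with hf
  have hpos : ∀ ρ ∈ Ioi r, 0 < ρ ^ 2 - r ^ 2 := fun ρ hρ => by
    have : r < ρ := hρ
    nlinarith
  have hpos' : ∀ ρ ∈ Ioi r, 0 < c ^ 2 + ρ ^ 2 - r ^ 2 := fun ρ hρ => by
    nlinarith [hpos ρ hρ, sq_nonneg c]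
  have hfpos : ∀ ρ ∈ Ioi r, 0 < f ρ := fun ρ hρ => by
    have : c < √(c ^ 2 + ρ ^ 2 - r ^ 2) := Real.lt_sqrt_of_sq_lt (by nlinarith [hpos ρ hρ])
    simp only [hf]; linarith
  have hinv : ∀ ρ ∈ Ioi r, √(f ρ ^ 2 + 2 * c * f ρ + r ^ 2) = ρ := fun ρ hρ => by
    have h0 : 0 ≤ ρ := hr.trans (le_of_lt hρ)
    have : f ρ ^ 2 + 2 * c * f ρ + r ^ 2 = ρ ^ 2 := by
      have := Real.sq_sqrt (hpos' ρ hρ).le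
      simp only [hf]; nlinarith
    rw [this, Real.sqrt_sq h0]
  have hinj : InjOn f (Ioi r) := fun a ha b hb hab => by
    rw [← hinv a ha, ← hinv b hb, hab]
  have himage : f '' Ioi r = {t | 0 < t ∧ r < √(t ^ 2 + 2 * c * t + r ^ 2)} := by
    ext t
    constructor
    · rintro ⟨ρ, hρ, rfl⟩
      exact ⟨hfpos ρ hρ, by rw [hinv ρ hρ]; exact hρ⟩
    · rintro ⟨ht, h⟩
      refine ⟨_, h, ?_⟩
      have h2 : r ^ 2 < t ^ 2 + 2 * c * t + r ^ 2 := (Real.lt_sqrt hr).1 h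
      have h3 : 0 < t + 2 * c := by
        by_contra hcon
        push Not at hcon
        nlinarith
      have h4 : c ^ 2 + √(t ^ 2 + 2 * c * t + r ^ 2) ^ 2 - r ^ 2 = (t + c) ^ 2 := by
        rw [Real.sq_sqrt (by nlinarith [sq_nonneg r])]; ring
      simp only [hf]
      rw [h4, Real.sqrt_sq (by linarith)]; ring
  have hder : ∀ ρ ∈ Ioi r, HasDerivWithinAt f (ρ / √(c ^ 2 + ρ ^ 2 - r ^ 2)) (Ioi r) ρ :=
    fun ρ hρ => by
    have h1 : HasDerivAt (fun ρ : ℝ => c ^ 2 + ρ ^ 2 - r ^ 2) (2 * ρ) ρ := by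
      simpa using ((hasDerivAt_pow 2 ρ).const_add (c ^ 2)).sub_const (r ^ 2)
    have h2 := (h1.sqrt (hpos' ρ hρ).ne').const_add (-c)
    refine (h2.congr_deriv ?_).hasDerivWithinAt
    rw [mul_div_mul_left _ _ two_ne_zero]
  have hsub : MeasurableSet {t : ℝ | 0 < t ∧ r < √(t ^ 2 + 2 * c * t + r ^ 2)} := by
    rw [ofPred_and]
    exact (measurableSet_lt measurable_const measurable_id).inter
      (measurableSet_lt measurable_const (by fun_prop))
  have h := lintegral_image_eq_lintegral_abs_deriv_mul measurableSet_Ioi hder hinj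
    (fun t => ENNReal.ofReal t⁻¹ * g (√(t ^ 2 + 2 * c * t + r ^ 2)))
  rw [himage] at h
  calc _ = ∫⁻ t in {t | 0 < t ∧ r < √(t ^ 2 + 2 * c * t + r ^ 2)},
        ENNReal.ofReal t⁻¹ * g (√(t ^ 2 + 2 * c * t + r ^ 2)) := by
        rw [← lintegral_indicator measurableSet_Ioi, ← lintegral_indicator hsub]
        refine lintegral_congr fun t => ?_
        by_cases h1 : 0 < t <;> by_cases h2 : r < √(t ^ 2 + 2 * c * t + r ^ 2) <;>
          simp [indicator, h1, h2]
    _ = _ := h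
    _ = _ := by
        refine setLIntegral_congr_fun measurableSet_Ioi fun ρ hρ => ?_
        have h0 : 0 ≤ ρ := hr.trans (le_of_lt hρ)
        rw [hinv ρ hρ, abs_of_nonneg (by positivity), ← mul_assoc,
          ← ENNReal.ofReal_mul (by positivity), ← div_eq_mul_inv]

theorem lintegral_chord_eq (r c : ℝ) (hr : 0 ≤ r) {g : ℝ → ℝ≥0∞} (hg : Measurable g) :
    ∫⁻ t in Ioi (0 : ℝ), ENNReal.ofReal t⁻¹ *
        ((Ioi r).indicator g (√(t ^ 2 + 2 * c * t + r ^ 2)) +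
          (Ioi r).indicator g (√(t ^ 2 + 2 * (-c) * t + r ^ 2))) =
      2 * ∫⁻ ρ in Ioi r, ENNReal.ofReal (ρ / (ρ ^ 2 - r ^ 2)) * g ρ := by
  have hgi : Measurable ((Ioi r).indicator g) := hg.indicator measurableSet_Ioi
  simp_rw [mul_add]
  rw [lintegral_add_left (by fun_prop), lintegral_ray_eq r c hr, lintegral_ray_eq r (-c) hr,
    ← lintegral_add_left (by fun_prop), ← lintegral_const_mul _ (by fun_prop)]
  refine setLIntegral_congr_fun measurableSet_Ioi fun ρ hρ => ?_
  have h0 : r < ρ := hρ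
  have hD : 0 < ρ ^ 2 - r ^ 2 := by nlinarith
  have hS : 0 < c ^ 2 + ρ ^ 2 - r ^ 2 := by nlinarith [sq_nonneg c]
  have hs := Real.sq_sqrt hS.le
  have hs0 := Real.sqrt_pos.2 hS
  have h1 : c < √(c ^ 2 + ρ ^ 2 - r ^ 2) := Real.lt_sqrt_of_sq_lt (by nlinarith)
  have h2 : -c < √(c ^ 2 + ρ ^ 2 - r ^ 2) := Real.lt_sqrt_of_sq_lt (by nlinarith)
  simp only [even_two, Even.neg_pow, neg_neg]
  set S := √(c ^ 2 + ρ ^ 2 - r ^ 2)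
  have h3 : 0 < -c + S := by linarith
  have h4 : 0 < c + S := by linarith
  have h5 : 0 ≤ ρ := by linarith
  rw [← add_mul, ← ENNReal.ofReal_add (by positivity) (by positivity), ← mul_assoc,
    ← ENNReal.ofReal_ofNat 2, ← ENNReal.ofReal_mul (by norm_num)]
  congr 2
  have : ρ ^ 2 - r ^ 2 = (-c + S) * (c + S) := by nlinarith
  rw [this]
  field_simp
  ring

variable {E : Type*} [NormedAddCommGroup E] [InnerProductSpace ℝ E]
  [MeasurableSpace E] [BorelSpace E] [FiniteDimensional ℝ E] [Nontrivial E]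
  (μ : Measure E) [μ.IsAddHaarMeasure]

theorem lintegral_radial_mul_inv_norm_sub_pow (x : E) {g : ℝ → ℝ≥0∞} (hg : Measurable g) :
    ∫⁻ y, (Ioi ‖x‖).indicator g ‖y‖ *
        ENNReal.ofReal (‖y - x‖ ^ Module.finrank ℝ E)⁻¹ ∂μ =
      μ.toSphere univ * ∫⁻ ρ in Ioi ‖x‖, ENNReal.ofReal (ρ / (ρ ^ 2 - ‖x‖ ^ 2)) * g ρ := by
  have hgi : Measurable ((Ioi ‖x‖).indicator g) := hg.indicator measurableSet_Ioi
  set G := (Ioi ‖x‖).indicator g with hG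
  have h1 : ∫⁻ y, G ‖y‖ * ENNReal.ofReal (‖y - x‖ ^ Module.finrank ℝ E)⁻¹ ∂μ =
      ∫⁻ z, G ‖x + z‖ * ENNReal.ofReal (‖z‖ ^ Module.finrank ℝ E)⁻¹ ∂μ := by
    rw [← lintegral_add_left_eq_self _ x]
    simp
  have h2 : ∫⁻ z, G ‖x + z‖ * ENNReal.ofReal (‖z‖ ^ Module.finrank ℝ E)⁻¹ ∂μ =
      ∫⁻ z, G ‖x - z‖ * ENNReal.ofReal (‖z‖ ^ Module.finrank ℝ E)⁻¹ ∂μ := by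
    rw [← lintegral_neg_eq_self]
    simp [sub_eq_add_neg]
  have h3 : 2 * ∫⁻ z, G ‖x + z‖ * ENNReal.ofReal (‖z‖ ^ Module.finrank ℝ E)⁻¹ ∂μ =
      2 * (μ.toSphere univ *
        ∫⁻ ρ in Ioi ‖x‖, ENNReal.ofReal (ρ / (ρ ^ 2 - ‖x‖ ^ 2)) * g ρ) := by
    nth_rewrite 1 [two_mul]
    nth_rewrite 2 [h2]
    rw [← lintegral_add_left (by fun_prop), lintegral_eq_lintegral_toSphere_Ioi μ (by fun_prop)]
    calc _ = ∫⁻ σ : sphere (0 : E) 1,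
          (2 * ∫⁻ ρ in Ioi ‖x‖, ENNReal.ofReal (ρ / (ρ ^ 2 - ‖x‖ ^ 2)) * g ρ) ∂μ.toSphere := by
          refine lintegral_congr fun σ => ?_
          rw [← lintegral_chord_eq ‖x‖ (inner ℝ x (σ : E)) (norm_nonneg x) hg]
          refine setLIntegral_congr_fun measurableSet_Ioi fun t ht => ?_
          have ht : 0 < t := ht
          have hσ : ‖(σ : E)‖ = 1 := by simp
          have e1 : ‖x + t • (σ : E)‖ = √(t ^ 2 + 2 * inner ℝ x (σ : E) * t + ‖x‖ ^ 2) := by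
            rw [← Real.sqrt_sq (norm_nonneg _), norm_add_sq_real, norm_smul, inner_smul_right, hσ,
              Real.norm_of_nonneg ht.le]
            congr 1; ring
          have e2 : ‖x - t • (σ : E)‖ = √(t ^ 2 + 2 * -inner ℝ x (σ : E) * t + ‖x‖ ^ 2) := by
            rw [← Real.sqrt_sq (norm_nonneg _), norm_sub_sq_real, norm_smul, inner_smul_right, hσ,
              Real.norm_of_nonneg ht.le]
            congr 1; ring
          rw [e1, e2, ← add_mul, ← hG, mul_comm (_ + _), ← mul_assoc,
            ← ENNReal.ofReal_mul (by positivity), norm_smul, hσ, mul_one,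
            Real.norm_of_nonneg ht.le]
          congr 2
          obtain ⟨m, hm⟩ : ∃ m, Module.finrank ℝ E = m + 1 :=
            ⟨_, (Nat.sub_add_cancel Module.finrank_pos).symm⟩
          rw [hm]
          simp only [Nat.add_sub_cancel, pow_succ]
          field_simp
      _ = _ := by
          rw [lintegral_const]
          ring
  rw [h1]
  exact (ENNReal.mul_right_inj (by norm_num) (by norm_num)).1 h3

theorem lintegral_sphere_inv_norm_sub_pow (p : E) (hp : ‖p‖ < 1) :
    ∫⁻ σ : sphere (0 : E) 1,
        ENNReal.ofReal (‖(σ : E) - p‖ ^ Module.finrank ℝ E)⁻¹ ∂μ.toSphere =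
      μ.toSphere univ * ENNReal.ofReal (1 / (1 - ‖p‖ ^ 2)) := by
  set N := Module.finrank ℝ E with hN
  have hN1 : 0 < N := Module.finrank_pos
  have hp0 := norm_nonneg p
  -- the weighted integral over the sphere of radius `ρ`
  set M : ℝ → ℝ≥0∞ := fun ρ => ∫⁻ σ : sphere (0 : E) 1,
    ENNReal.ofReal (ρ ^ (N - 1)) * ENNReal.ofReal (‖ρ • (σ : E) - p‖ ^ N)⁻¹ ∂μ.toSphere with hM
  have hMm : Measurable M := by
    refine Measurable.lintegral_prod_right' (f := fun q : ℝ × sphere (0 : E) 1 =>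
      ENNReal.ofReal (q.1 ^ (N - 1)) * ENNReal.ofReal (‖q.1 • (q.2 : E) - p‖ ^ N)⁻¹) ?_
    fun_prop
  have hae : M =ᵐ[volume.restrict (Ioi ‖p‖)]
      fun ρ => μ.toSphere univ * ENNReal.ofReal (ρ / (ρ ^ 2 - ‖p‖ ^ 2)) := by
    refine ae_eq_of_forall_setLIntegral_eq_of_sigmaFinite hMm (by fun_prop) fun s hs _ => ?_
    have h := lintegral_radial_mul_inv_norm_sub_pow μ p
      (g := s.indicator 1) (measurable_one.indicator hs)
    have hgi : Measurable ((Ioi ‖p‖).indicator (s.indicator (1 : ℝ → ℝ≥0∞))) :=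
      (measurable_one.indicator hs).indicator measurableSet_Ioi
    rw [lintegral_eq_lintegral_toSphere_Ioi μ (by fun_prop),
      lintegral_lintegral_swap (by fun_prop)] at h
    rw [lintegral_const_mul _ (by fun_prop)]
    rw [← lintegral_indicator hs, ← lintegral_indicator measurableSet_Ioi]
    rw [← lintegral_indicator hs, ← lintegral_indicator measurableSet_Ioi]
    rw [← lintegral_indicator measurableSet_Ioi, ← lintegral_indicator measurableSet_Ioi] at h
    convert h using 1
    · refine lintegral_congr fun ρ => ?_
      by_cases h1 : ‖p‖ < ρ
      · have h2 : 0 < ρ := hp0.trans_lt h1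
        have h3 : ∀ σ : sphere (0 : E) 1, ‖ρ • (σ : E)‖ = ρ := fun σ => by
          rw [norm_smul, Real.norm_of_nonneg h2.le]; simp
        by_cases h4 : ρ ∈ s
        · simp [indicator, h1, h2, h3, h4, hM, hN]
        · simp [indicator, h1, h2, h3, h4]
      · by_cases h2 : 0 < ρ
        · have h3 : ∀ σ : sphere (0 : E) 1, ‖ρ • (σ : E)‖ = ρ := fun σ => by
            rw [norm_smul, Real.norm_of_nonneg h2.le]; simp
          simp [indicator, h1, h2, h3]
        · simp [indicator, h1, h2]
    · congr 1
      refine lintegral_congr fun ρ => ?_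
      by_cases h1 : ‖p‖ < ρ <;> by_cases h4 : ρ ∈ s <;> simp [indicator, h1, h4]
  have hcont : ContinuousOn M (Ioi ‖p‖) := by
    rw [continuousOn_iff_continuous_domRestrict]
    have hc : Continuous (Function.uncurry fun (ρ : Ioi ‖p‖) (σ : sphere (0 : E) 1) =>
        (ρ : ℝ) ^ (N - 1) * (‖(ρ : ℝ) • (σ : E) - p‖ ^ N)⁻¹) := by
      refine Continuous.mul (by fun_prop) (Continuous.inv₀ (by fun_prop) ?_)
      rintro ⟨⟨ρ, hρ⟩, σ⟩
      have h2 : 0 < ρ := hp0.trans_lt hρ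
      refine pow_ne_zero _ (norm_ne_zero_iff.2 fun h => ?_)
      have := congrArg norm (sub_eq_zero.1 h)
      rw [norm_smul, Real.norm_of_nonneg h2.le] at this
      simp at this
      exact absurd this (ne_of_gt hρ)
    have : LocallyCompactSpace (Ioi ‖p‖) := isOpen_Ioi.locallyCompactSpace
    have := (continuous_parametric_integral_of_continuous (μ := μ.toSphere) hc
      isCompact_univ)
    refine (ENNReal.continuous_ofReal.comp this).congr fun ρ => ?_
    have h2 : 0 < (ρ : ℝ) := hp0.trans_lt ρ.2
    simp only [Function.comp, setIntegral_univ, domRestrict_apply, hM]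
    rw [ofReal_integral_eq_lintegral_ofReal]
    · refine lintegral_congr fun σ => ?_
      rw [ENNReal.ofReal_mul (by positivity)]
    · exact (hc.comp (Continuous.prodMk_right ρ)).integrable_of_hasCompactSupport
        (HasCompactSupport.of_compactSpace _)
    · exact Filter.Eventually.of_forall fun σ => by positivity
  have hcont2 : ContinuousOn
      (fun ρ => μ.toSphere univ * ENNReal.ofReal (ρ / (ρ ^ 2 - ‖p‖ ^ 2))) (Ioi ‖p‖) := by
    refine ContinuousOn.congr (f := fun ρ => ENNReal.ofReal
      ((μ.toSphere univ).toReal * (ρ / (ρ ^ 2 - ‖p‖ ^ 2)))) ?_ fun ρ _ => ?_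
    · refine ENNReal.continuous_ofReal.comp_continuousOn (continuousOn_const.mul ?_)
      refine ContinuousOn.div (by fun_prop) (by fun_prop) fun ρ hρ => ?_
      have : ‖p‖ < ρ := hρ
      nlinarith
    · simp only
      rw [ENNReal.ofReal_mul ENNReal.toReal_nonneg, ENNReal.ofReal_toReal (measure_ne_top _ _)]
  have := Measure.eqOn_open_of_ae_eq hae isOpen_Ioi hcont hcont2 (show (1 : ℝ) ∈ Ioi ‖p‖ from hp)
  simpa [hM] using this

end Sphere

section Reduction

open Set Metric
open scoped ENNReal

theorem lintegral_Ioo_green_subst {X Y K d s m : ℝ} (hX : 0 ≤ X) (hY : 0 < Y) (hXK : X < K)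
    (hYK : Y < K) (hd : 0 < d) :
    ∫⁻ w in Ioo 0 ((K - X) * (K - Y) / (K * d)),
        ENNReal.ofReal (w ^ (s - 1) * (1 + w) ^ (-m)) =
      ENNReal.ofReal (d ^ (m - s)) * ∫⁻ k in Ioo (max X Y) K,
        ENNReal.ofReal (((k - X) * (k - Y) / k) ^ (s - 1) * (1 - X * Y / k ^ 2) *
          (d + (k - X) * (k - Y) / k) ^ (-m)) := by
  set f : ℝ → ℝ := fun k => (k - X) * (k - Y) / (k * d) with hf
  set M := max X Y with hM
  have hM0 : 0 < M := hY.trans_le (le_max_right _ _)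
  have hMK : M < K := max_lt hXK hYK
  have hXM : X ≤ M := le_max_left _ _
  have hYM : Y ≤ M := le_max_right _ _
  have hfM : f M = 0 := by
    rcases max_choice X Y with h | h <;> simp [hf, hM, h]
  have hXY : ∀ k, M < k → X * Y < k ^ 2 := fun k hk => by nlinarith
  have hmono : StrictMonoOn f (Icc M K) := by
    intro a ha b hb hab
    have ha0 : 0 < a := hM0.trans_le ha.1
    have hb0 : 0 < b := ha0.trans hab
    have hXa : X ≤ a := hXM.trans ha.1
    have hYa : Y ≤ a := hYM.trans ha.1
    have : f b - f a = (b - a) * (a * b - X * Y) / (a * b * d) := by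
      simp only [hf]; field_simp; ring
    have h2 : X * Y < a * b := by nlinarith
    have : 0 < f b - f a := by
      rw [this]
      have := sub_pos.2 hab
      have := sub_pos.2 h2
      positivity
    linarith
  have hcont : ContinuousOn f (Icc M K) := by
    refine ContinuousOn.div (by fun_prop) (by fun_prop) fun k hk => ?_
    have : 0 < k := hM0.trans_le hk.1
    positivity
  have himage : f '' Ioo M K = Ioo 0 (f K) := by
    refine Subset.antisymm ?_ (hfM ▸ intermediate_value_Ioo hMK.le hcont)
    rintro _ ⟨k, hk, rfl⟩
    refine ⟨hfM ▸ hmono (left_mem_Icc.2 hMK.le) (Ioo_subset_Icc_self hk) hk.1, ?_⟩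
    exact hmono (Ioo_subset_Icc_self hk) (right_mem_Icc.2 hMK.le) hk.2
  have hder : ∀ k ∈ Ioo M K, HasDerivWithinAt f ((1 - X * Y / k ^ 2) / d) (Ioo M K) k := by
    intro k hk
    have hk0 : 0 < k := hM0.trans hk.1
    have h1 : HasDerivAt (fun k : ℝ => (k - X) * (k - Y)) (1 * (k - Y) + (k - X) * 1) k :=
      ((hasDerivAt_id k).sub_const X).mul ((hasDerivAt_id k).sub_const Y)
    have h2 : HasDerivAt (fun k : ℝ => k * d) (1 * d) k := (hasDerivAt_id k).mul_const d
    refine ((h1.div h2 (by positivity)).congr_deriv ?_).hasDerivWithinAt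
    field_simp
    ring
  have h := lintegral_image_eq_lintegral_abs_deriv_mul measurableSet_Ioo hder
    (hmono.injOn.mono Ioo_subset_Icc_self)
    (fun w => ENNReal.ofReal (w ^ (s - 1) * (1 + w) ^ (-m)))
  rw [himage] at h
  rw [h, ← lintegral_const_mul' _ _ ENNReal.ofReal_ne_top]
  refine setLIntegral_congr_fun measurableSet_Ioo fun k hk => ?_
  have hk0 : 0 < k := hM0.trans hk.1
  have hD : 0 < 1 - X * Y / k ^ 2 := by
    rw [sub_pos, div_lt_one (by positivity)]
    exact hXY k hk.1
  have h1 : 0 < k - X := sub_pos.2 (hXM.trans_lt hk.1)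
  have h2 : 0 < k - Y := sub_pos.2 (hYM.trans_lt hk.1)
  set v := (k - X) * (k - Y) / k with hv
  have hv0 : 0 < v := by positivity
  have hfv : f k = v / d := by simp only [hf, hv]; field_simp
  rw [abs_of_pos (by positivity), ← ENNReal.ofReal_mul (by positivity),
    ← ENNReal.ofReal_mul (by positivity), hfv]
  congr 1
  have e1 : 1 + v / d = (d + v) / d := by field_simp
  rw [e1, Real.div_rpow hv0.le hd.le, Real.div_rpow (by positivity) hd.le]
  have e2 : d ^ (m - s) = (d ^ (-m))⁻¹ * (d ^ (s - 1))⁻¹ * d⁻¹ := by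
    rw [← Real.rpow_neg hd.le, ← Real.rpow_neg hd.le, ← Real.rpow_neg_one, ← Real.rpow_add hd,
      ← Real.rpow_add hd]
    congr 1; ring
  rw [e2]
  simp only [div_eq_mul_inv]
  ring

variable {E : Type*} [NormedAddCommGroup E] [InnerProductSpace ℝ E]
  [MeasurableSpace E] [BorelSpace E] [FiniteDimensional ℝ E] [Nontrivial E]
  (μ : Measure E) [μ.IsAddHaarMeasure]

theorem lintegral_sphere_rpow (x : E) {ρ k : ℝ} (hρ : 0 ≤ ρ) (hxk : ‖x‖ ^ 2 < k)
    (hρk : ρ ^ 2 < k) :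
    ∫⁻ σ : sphere (0 : E) 1, ENNReal.ofReal ((k + ‖x‖ ^ 2 * ρ ^ 2 / k -
        2 * inner ℝ x (ρ • (σ : E))) ^ (-((Module.finrank ℝ E : ℝ) / 2))) ∂μ.toSphere =
      μ.toSphere univ * ENNReal.ofReal (k ^ (-((Module.finrank ℝ E : ℝ) / 2)) /
        (1 - ‖x‖ ^ 2 * ρ ^ 2 / k ^ 2)) := by
  have hk : 0 < k := (sq_nonneg ρ).trans_lt hρk
  have hp : ‖(ρ / k) • x‖ < 1 := by
    rw [norm_smul, Real.norm_of_nonneg (by positivity), div_mul_eq_mul_div, div_lt_one hk]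
    have := norm_nonneg x
    nlinarith [sq_nonneg (ρ - ‖x‖)]
  have h := lintegral_sphere_inv_norm_sub_pow μ ((ρ / k) • x) hp
  have hp2 : ‖(ρ / k) • x‖ ^ 2 = ‖x‖ ^ 2 * ρ ^ 2 / k ^ 2 := by
    rw [norm_smul, Real.norm_of_nonneg (by positivity)]
    field_simp
  have e : k ^ (-((Module.finrank ℝ E : ℝ) / 2)) / (1 - ‖x‖ ^ 2 * ρ ^ 2 / k ^ 2) =
      k ^ (-((Module.finrank ℝ E : ℝ) / 2)) * (1 / (1 - ‖x‖ ^ 2 * ρ ^ 2 / k ^ 2)) := by ring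
  rw [e, ENNReal.ofReal_mul (by positivity), mul_left_comm, ← hp2, ← h,
    ← lintegral_const_mul' _ _ ENNReal.ofReal_ne_top]
  refine lintegral_congr fun σ => ?_
  rw [← ENNReal.ofReal_mul (by positivity)]
  have hσ : ‖(σ : E)‖ = 1 := by simp
  have h1 : k + ‖x‖ ^ 2 * ρ ^ 2 / k - 2 * inner ℝ x (ρ • (σ : E)) =
      k * ‖(σ : E) - (ρ / k) • x‖ ^ 2 := by
    rw [norm_sub_sq_real, hp2, hσ, inner_smul_right, inner_smul_right, real_inner_comm x]
    field_simp
    ring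
  rw [h1, Real.mul_rpow hk.le (by positivity), ← Real.rpow_natCast, ← Real.rpow_natCast,
    ← Real.rpow_mul (norm_nonneg _), ← Real.rpow_neg (norm_nonneg _)]
  congr 3
  push_cast
  ring

theorem lintegral_Ioo_rescale {Q k s : ℝ} {N : ℕ} (hN : N ≠ 0) (hk : 0 < k) :
    ∫⁻ ρ in {ρ : ℝ | 0 < ρ ∧ ρ < Q ∧ ρ ^ 2 < k},
        ENNReal.ofReal (ρ ^ (N - 1) * ((k - ρ ^ 2) ^ (s - 1) * k ^ (1 - s - (N : ℝ) / 2))) =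
      ∫⁻ t in Ioo 0 (min 1 (Q / √k)), ENNReal.ofReal (t ^ (N - 1) * (1 - t ^ 2) ^ (s - 1)) := by
  have hk' : 0 < √k := Real.sqrt_pos.2 hk
  have himage : (fun t => √k * t) '' Ioo 0 (min 1 (Q / √k)) =
      {ρ : ℝ | 0 < ρ ∧ ρ < Q ∧ ρ ^ 2 < k} := by
    ext ρ
    constructor
    · rintro ⟨t, ⟨h0, h1⟩, rfl⟩
      have h2 := lt_min_iff.1 h1
      refine ⟨by positivity, ?_, ?_⟩
      · have := (lt_div_iff₀ hk').1 h2.2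
        simp only; linarith
      · simp only
        rw [mul_pow, Real.sq_sqrt hk.le]
        exact mul_lt_of_lt_one_right hk (by nlinarith [h2.1])
    · rintro ⟨h0, h1, h2⟩
      refine ⟨ρ / √k, ⟨by positivity, lt_min ?_ ?_⟩, by field_simp⟩
      · rw [div_lt_one hk']
        exact Real.lt_sqrt_of_sq_lt h2
      · exact div_lt_div_of_pos_right h1 hk'
  have hder : ∀ t ∈ Ioo 0 (min 1 (Q / √k)),
      HasDerivWithinAt (fun t => √k * t) (√k) (Ioo 0 (min 1 (Q / √k))) t := fun t _ => by
    simpa using ((hasDerivAt_id t).const_mul (√k)).hasDerivWithinAt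
  have h := lintegral_image_eq_lintegral_abs_deriv_mul measurableSet_Ioo hder
    (mul_right_injective₀ hk'.ne').injOn (fun ρ => ENNReal.ofReal
      (ρ ^ (N - 1) * ((k - ρ ^ 2) ^ (s - 1) * k ^ (1 - s - (N : ℝ) / 2))))
  rw [himage] at h
  rw [h]
  refine setLIntegral_congr_fun measurableSet_Ioo fun t ht => ?_
  have h1 : t < 1 := (lt_min_iff.1 ht.2).1
  have h2 : 0 < 1 - t ^ 2 := by nlinarith [ht.1]
  rw [abs_of_pos hk', ← ENNReal.ofReal_mul hk'.le]
  congr 1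
  have e1 : k - (√k * t) ^ 2 = k * (1 - t ^ 2) := by
    rw [mul_pow, Real.sq_sqrt hk.le]; ring
  have e2 : √k * √k ^ (N - 1) = k ^ ((N : ℝ) / 2) := by
    rw [← pow_succ', Nat.sub_add_cancel (Nat.pos_of_ne_zero hN), Real.sqrt_eq_rpow,
      ← Real.rpow_natCast, ← Real.rpow_mul hk.le]
    congr 1; ring
  rw [e1, Real.mul_rpow hk.le h2.le, mul_pow]
  have e3 : k ^ ((N : ℝ) / 2) * k ^ (s - 1) * k ^ (1 - s - (N : ℝ) / 2) = 1 := by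
    rw [← Real.rpow_add hk, ← Real.rpow_add hk]
    ring_nf
    simp
  calc _ = (√k * √k ^ (N - 1) * k ^ (s - 1) * k ^ (1 - s - (N : ℝ) / 2)) *
        (t ^ (N - 1) * (1 - t ^ 2) ^ (s - 1)) := by ring
    _ = _ := by rw [e2, e3, one_mul]

theorem setLIntegral_ball_green (x : E) (Q K s : ℝ) :
    ∫⁻ y in ball (0 : E) Q, (∫⁻ k in Ioo (max (‖x‖ ^ 2) (‖y‖ ^ 2)) K,
        ENNReal.ofReal (((k - ‖x‖ ^ 2) * (k - ‖y‖ ^ 2) / k) ^ (s - 1) *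
          (1 - ‖x‖ ^ 2 * ‖y‖ ^ 2 / k ^ 2) *
          (k + ‖x‖ ^ 2 * ‖y‖ ^ 2 / k - 2 * inner ℝ x y) ^
            (-((Module.finrank ℝ E : ℝ) / 2)))) ∂μ =
      μ.toSphere univ * ∫⁻ k in Ioo (‖x‖ ^ 2) K, ENNReal.ofReal ((k - ‖x‖ ^ 2) ^ (s - 1)) *
        ∫⁻ t in Ioo 0 (min 1 (Q / √k)),
          ENNReal.ofReal (t ^ (Module.finrank ℝ E - 1) * (1 - t ^ 2) ^ (s - 1)) := by
  set N := Module.finrank ℝ E with hN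
  have hN1 : N ≠ 0 := Module.finrank_pos.ne'
  set F : E × ℝ → ℝ≥0∞ := fun q => ENNReal.ofReal
    (((q.2 - ‖x‖ ^ 2) * (q.2 - ‖q.1‖ ^ 2) / q.2) ^ (s - 1) *
      (1 - ‖x‖ ^ 2 * ‖q.1‖ ^ 2 / q.2 ^ 2) *
      (q.2 + ‖x‖ ^ 2 * ‖q.1‖ ^ 2 / q.2 - 2 * inner ℝ x q.1) ^ (-((N : ℝ) / 2))) with hF
  have hFm : Measurable F := by fun_prop
  set T : Set (E × ℝ) := {q | (‖q.1‖ < Q ∧ ‖q.1‖ ^ 2 < q.2) ∧ ‖x‖ ^ 2 < q.2 ∧ q.2 < K} with hT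
  have hTm : MeasurableSet T := by
    simp only [hT, ofPred_and]
    exact ((measurableSet_lt (by fun_prop) (by fun_prop)).inter
      (measurableSet_lt (by fun_prop) (by fun_prop))).inter
      ((measurableSet_lt (by fun_prop) (by fun_prop)).inter
      (measurableSet_lt (by fun_prop) (by fun_prop)))
  have hTF : Measurable (T.indicator F) := hFm.indicator hTm
  have hball : ∫⁻ y in ball (0 : E) Q, (∫⁻ k in Ioo (max (‖x‖ ^ 2) (‖y‖ ^ 2)) K, F (y, k)) ∂μ =
      ∫⁻ y, (∫⁻ k, T.indicator F (y, k)) ∂μ := by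
    rw [← lintegral_indicator measurableSet_ball]
    refine lintegral_congr fun y => ?_
    by_cases hy : ‖y‖ < Q
    · rw [indicator_of_mem (by simpa using hy), ← lintegral_indicator measurableSet_Ioo]
      refine lintegral_congr fun k => ?_
      by_cases h1 : ‖x‖ ^ 2 < k <;> by_cases h2 : ‖y‖ ^ 2 < k <;> by_cases h3 : k < K <;>
        simp [indicator, hT, hy, h1, h2, h3]
    · rw [indicator_of_notMem (by simpa using hy)]
      simp [indicator, hT, hy]
  refine hball.trans ?_
  rw [lintegral_lintegral_swap (by fun_prop), ← lintegral_const_mul' _ _ (measure_ne_top _ _),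
    ← lintegral_indicator measurableSet_Ioo]
  refine lintegral_congr fun k => ?_
  by_cases hk : k ∈ Ioo (‖x‖ ^ 2) K
  swap
  · rw [indicator_of_notMem hk]
    simp only [mem_Ioo] at hk
    simp [indicator, hT, hk]
  rw [indicator_of_mem hk]
  have hk0 : 0 < k := (sq_nonneg _).trans_lt hk.1
  have hkX : 0 < k - ‖x‖ ^ 2 := sub_pos.2 hk.1
  rw [lintegral_eq_lintegral_toSphere_Ioi μ (by fun_prop), lintegral_lintegral_swap (by fun_prop),
    ← lintegral_Ioo_rescale hN1 hk0, ← lintegral_const_mul' _ _ ENNReal.ofReal_ne_top,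
    ← lintegral_const_mul' _ _ (measure_ne_top _ _)]
  have hS : MeasurableSet {ρ : ℝ | 0 < ρ ∧ ρ < Q ∧ ρ ^ 2 < k} := by
    simp only [ofPred_and]
    exact (measurableSet_lt (by fun_prop) (by fun_prop)).inter
      ((measurableSet_lt (by fun_prop) (by fun_prop)).inter
      (measurableSet_lt (by fun_prop) (by fun_prop)))
  rw [← lintegral_indicator measurableSet_Ioi, ← lintegral_indicator hS]
  refine lintegral_congr fun ρ => ?_
  by_cases hρ : 0 < ρ
  swap
  · simp [indicator, hρ]
  have hnorm : ∀ σ : sphere (0 : E) 1, ‖ρ • (σ : E)‖ = ρ := fun σ => by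
    rw [norm_smul, Real.norm_of_nonneg hρ.le]; simp
  rw [indicator_of_mem (show ρ ∈ Ioi 0 from hρ)]
  by_cases hρS : ρ < Q ∧ ρ ^ 2 < k
  swap
  · rw [indicator_of_notMem (fun h => hρS h.2)]
    simp [indicator, hT, hnorm, hρS]
  rw [indicator_of_mem (show ρ ∈ {ρ : ℝ | 0 < ρ ∧ ρ < Q ∧ ρ ^ 2 < k} from ⟨hρ, hρS⟩)]
  have hkρ : 0 < k - ρ ^ 2 := sub_pos.2 hρS.2
  have hD : 0 < 1 - ‖x‖ ^ 2 * ρ ^ 2 / k ^ 2 := by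
    rw [sub_pos, div_lt_one (by positivity)]
    nlinarith [hk.1, hρS.2, sq_nonneg ‖x‖, sq_nonneg ρ]
  have hind : ∀ σ : sphere (0 : E) 1, T.indicator F (ρ • (σ : E), k) =
      ENNReal.ofReal (((k - ‖x‖ ^ 2) * (k - ρ ^ 2) / k) ^ (s - 1) *
        (1 - ‖x‖ ^ 2 * ρ ^ 2 / k ^ 2)) *
      ENNReal.ofReal ((k + ‖x‖ ^ 2 * ρ ^ 2 / k -
        2 * inner ℝ x (ρ • (σ : E))) ^ (-((N : ℝ) / 2))) := fun σ => by
    have hmem : (ρ • (σ : E), k) ∈ T := by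
      simp only [hT, mem_ofPred_eq, hnorm]
      exact ⟨hρS, hk⟩
    rw [indicator_of_mem hmem]
    simp only [hF, hnorm]
    rw [ENNReal.ofReal_mul (by positivity)]
  simp_rw [hind]
  rw [lintegral_const_mul' _ _ ENNReal.ofReal_ne_top,
    lintegral_const_mul' _ _ ENNReal.ofReal_ne_top,
    lintegral_sphere_rpow μ x hρ.le hk.1 hρS.2, mul_left_comm _ (μ.toSphere univ),
    mul_left_comm _ (μ.toSphere univ)]
  congr 1
  rw [← ENNReal.ofReal_mul (by positivity), ← ENNReal.ofReal_mul (by positivity),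
    ← ENNReal.ofReal_mul (by positivity)]
  congr 1
  have e1 : k ^ (1 - s - (N : ℝ) / 2) = (k ^ (s - 1))⁻¹ * k ^ (-((N : ℝ) / 2)) := by
    rw [← Real.rpow_neg hk0.le, ← Real.rpow_add hk0]
    congr 1; ring
  rw [e1, Real.div_rpow (by positivity) hk0.le, Real.mul_rpow hkX.le hkρ.le]
  rw [← hN]
  generalize 1 - ‖x‖ ^ 2 * ρ ^ 2 / k ^ 2 = D at hD
  field_simp

end Reduction

section AbelTransform

open Set
open scoped ENNReal

theorem lintegral_Ioo_rpow_sub_one {a s : ℝ} (ha : 0 ≤ a) (hs : 0 < s) :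
    ∫⁻ t in Ioo 0 a, ENNReal.ofReal (t ^ (s - 1)) = ENNReal.ofReal (a ^ s / s) := by
  have hi : IntervalIntegrable (fun t : ℝ => t ^ (s - 1)) volume 0 a :=
    intervalIntegral.intervalIntegrable_rpow' (by linarith)
  rw [restrict_Ioo_eq_restrict_Ioc, ← ofReal_integral_eq_lintegral_ofReal hi.1,
    ← intervalIntegral.integral_of_le ha, integral_rpow (Or.inl (by linarith))]
  · simp [Real.zero_rpow hs.ne']
  · filter_upwards [ae_restrict_mem measurableSet_Ioc] with t ht
    exact Real.rpow_nonneg ht.1.le _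

theorem lintegral_Ioo_abel_rescale {X K : ℝ} (s : ℝ) (hXK : X < K) (γ : ℝ → ℝ≥0∞) :
    ∫⁻ k in Ioo X K, ENNReal.ofReal ((k - X) ^ (s - 1)) * γ k =
      ENNReal.ofReal ((K - X) ^ s) *
        ∫⁻ t in Ioo 0 1, ENNReal.ofReal (t ^ (s - 1)) * γ (X + (K - X) * t) := by
  have hL : 0 < K - X := sub_pos.2 hXK
  have himage : (fun t => X + (K - X) * t) '' Ioo 0 1 = Ioo X K := by
    ext k
    constructor
    · rintro ⟨t, ⟨h0, h1⟩, rfl⟩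
      constructor <;> simp only <;> nlinarith
    · rintro ⟨h0, h1⟩
      refine ⟨(k - X) / (K - X), ⟨div_pos (by linarith) hL, ?_⟩, ?_⟩
      · rw [div_lt_one hL]; linarith
      · simp only
        rw [mul_div_cancel₀ _ hL.ne']; ring
  have hder : ∀ t ∈ Ioo (0 : ℝ) 1,
      HasDerivWithinAt (fun t => X + (K - X) * t) (K - X) (Ioo 0 1) t := fun t _ => by
    simpa using (((hasDerivAt_id t).const_mul (K - X)).const_add X).hasDerivWithinAt
  have hinj : InjOn (fun t => X + (K - X) * t) (Ioo (0 : ℝ) 1) := fun a _ b _ h =>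
    mul_left_cancel₀ hL.ne' (add_left_cancel h)
  have h := lintegral_image_eq_lintegral_abs_deriv_mul measurableSet_Ioo hder hinj
    (fun k => ENNReal.ofReal ((k - X) ^ (s - 1)) * γ k)
  rw [himage] at h
  rw [h, ← lintegral_const_mul' _ _ ENNReal.ofReal_ne_top]
  refine setLIntegral_congr_fun measurableSet_Ioo fun t ht => ?_
  have ht0 : 0 < t := ht.1
  rw [← mul_assoc, ← mul_assoc, abs_of_pos hL, ← ENNReal.ofReal_mul hL.le,
    ← ENNReal.ofReal_mul (by positivity), add_sub_cancel_left, Real.mul_rpow hL.le ht0.le,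
    ← mul_assoc, Real.rpow_sub_one hL.ne', mul_div_cancel₀ _ hL.ne']

theorem lintegral_Ioo_abel_anti {X₁ X₂ K s : ℝ} (hs : 0 ≤ s) (h12 : X₁ ≤ X₂) (h2 : X₂ < K)
    {γ : ℝ → ℝ≥0∞} (hγ : AntitoneOn γ (Ioo X₁ K)) :
    ∫⁻ k in Ioo X₂ K, ENNReal.ofReal ((k - X₂) ^ (s - 1)) * γ k ≤
      ∫⁻ k in Ioo X₁ K, ENNReal.ofReal ((k - X₁) ^ (s - 1)) * γ k := by
  rw [lintegral_Ioo_abel_rescale s h2, lintegral_Ioo_abel_rescale s (h12.trans_lt h2)]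
  gcongr ?_ * ?_
  · exact ENNReal.ofReal_le_ofReal (Real.rpow_le_rpow (by linarith) (by linarith) hs)
  · refine setLIntegral_mono' measurableSet_Ioo fun t ht => ?_
    gcongr
    refine hγ ?_ ?_ ?_
    · constructor <;> nlinarith [ht.1, ht.2]
    · constructor <;> nlinarith [ht.1, ht.2]
    · nlinarith [ht.1, ht.2]

theorem lintegral_Ioo_beta_le {n : ℕ} (hn : 2 ≤ n) {s : ℝ} (hs : 0 < s) :
    ∫⁻ t in Ioo (0 : ℝ) 1, ENNReal.ofReal (t ^ (n - 1) * (1 - t ^ 2) ^ (s - 1)) ≤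
      ENNReal.ofReal (1 / (2 * s)) := by
  have himage : (fun t : ℝ => 1 - t ^ 2) '' Ioo 0 1 = Ioo 0 1 := by
    ext u
    constructor
    · rintro ⟨t, ⟨h0, h1⟩, rfl⟩
      constructor <;> simp only <;> nlinarith
    · rintro ⟨h0, h1⟩
      refine ⟨√(1 - u), ⟨Real.sqrt_pos.2 (by linarith), ?_⟩, ?_⟩
      · rw [Real.sqrt_lt' one_pos]; linarith
      · simp only
        rw [Real.sq_sqrt (by linarith)]; ring
  have hder : ∀ t ∈ Ioo (0 : ℝ) 1,
      HasDerivWithinAt (fun t : ℝ => 1 - t ^ 2) (-(2 * t)) (Ioo 0 1) t := fun t _ => by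
    simpa using ((hasDerivAt_pow 2 t).const_sub 1).hasDerivWithinAt
  have hinj : InjOn (fun t : ℝ => 1 - t ^ 2) (Ioo (0 : ℝ) 1) := fun a ha b hb h => by
    have : a ^ 2 = b ^ 2 := by simpa using h
    exact (sq_eq_sq₀ ha.1.le hb.1.le).1 this
  have h := lintegral_image_eq_lintegral_abs_deriv_mul measurableSet_Ioo hder hinj
    (fun u => ENNReal.ofReal (u ^ (s - 1)))
  rw [himage, lintegral_Ioo_rpow_sub_one zero_le_one hs, Real.one_rpow] at h
  have e : (1 : ℝ) / (2 * s) = 1 / 2 * (1 / s) := by field_simp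
  rw [e, ENNReal.ofReal_mul (by norm_num), h, ← lintegral_const_mul' _ _ ENNReal.ofReal_ne_top]
  refine setLIntegral_mono' measurableSet_Ioo fun t ht => ?_
  have h0 : 0 < t := ht.1
  have h1 : 0 < 1 - t ^ 2 := by nlinarith [ht.1, ht.2]
  rw [abs_neg, abs_of_pos (by positivity), ← ENNReal.ofReal_mul (by positivity),
    ← ENNReal.ofReal_mul (by norm_num)]
  refine ENNReal.ofReal_le_ofReal ?_
  have h2 : t ^ (n - 1) ≤ t := by
    simpa using pow_le_pow_of_le_one h0.le ht.2.le (show 1 ≤ n - 1 by omega)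
  have h3 : 0 ≤ (1 - t ^ 2) ^ (s - 1) := by positivity
  nlinarith

theorem le_lintegral_Ioo_beta {n : ℕ} (hn : 1 ≤ n) {s q : ℝ} (hs : s ≤ 1) (hq0 : 0 ≤ q)
    (hq1 : q ≤ 1) :
    ENNReal.ofReal (q ^ n / n) ≤
      ∫⁻ t in Ioo (0 : ℝ) q, ENNReal.ofReal (t ^ (n - 1) * (1 - t ^ 2) ^ (s - 1)) := by
  have h := lintegral_Ioo_rpow_sub_one hq0 (s := n) (by exact_mod_cast hn)
  rw [Real.rpow_natCast] at h
  rw [← h]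
  refine setLIntegral_mono' measurableSet_Ioo fun t ht => ENNReal.ofReal_le_ofReal ?_
  have h0 : 0 < t := ht.1
  have h1 : 0 < 1 - t ^ 2 := by nlinarith [ht.1, ht.2]
  have e : t ^ ((n : ℝ) - 1) = t ^ (n - 1) := by
    rw [← Real.rpow_natCast, Nat.cast_sub hn, Nat.cast_one]
  rw [e]
  exact le_mul_of_one_le_right (by positivity)
    (Real.one_le_rpow_of_pos_of_le_one_of_nonpos h1 (by nlinarith) (by linarith))

end AbelTransform

section GreenPotential

open Set Metric
open scoped ENNReal

theorem measurable_lintegral_Ioo_green {E : Type*} [NormedAddCommGroup E] [InnerProductSpace ℝ E]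
    [MeasurableSpace E] [BorelSpace E] [FiniteDimensional ℝ E] (x : E) (K s m : ℝ) :
    Measurable fun y : E => ∫⁻ k in Ioo (max (‖x‖ ^ 2) (‖y‖ ^ 2)) K,
      ENNReal.ofReal (((k - ‖x‖ ^ 2) * (k - ‖y‖ ^ 2) / k) ^ (s - 1) *
        (1 - ‖x‖ ^ 2 * ‖y‖ ^ 2 / k ^ 2) *
        (k + ‖x‖ ^ 2 * ‖y‖ ^ 2 / k - 2 * inner ℝ x y) ^ (-m)) := by
  have hT : MeasurableSet {q : E × ℝ | max (‖x‖ ^ 2) (‖q.1‖ ^ 2) < q.2 ∧ q.2 < K} := by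
    rw [ofPred_and]
    exact (measurableSet_lt (by fun_prop) (by fun_prop)).inter
      (measurableSet_lt (by fun_prop) (by fun_prop))
  have hF : Measurable fun q : E × ℝ => ENNReal.ofReal
      (((q.2 - ‖x‖ ^ 2) * (q.2 - ‖q.1‖ ^ 2) / q.2) ^ (s - 1) *
        (1 - ‖x‖ ^ 2 * ‖q.1‖ ^ 2 / q.2 ^ 2) *
        (q.2 + ‖x‖ ^ 2 * ‖q.1‖ ^ 2 / q.2 - 2 * inner ℝ x q.1) ^ (-m)) := by fun_prop
  convert (hF.indicator hT).lintegral_prod_right' (ν := volume) using 1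
  ext y
  rw [← lintegral_indicator measurableSet_Ioo]
  rfl

theorem fracGreen_eq {n : ℕ} {s R : ℝ} {x y : EuclideanSpace ℝ (Fin n)}
    (hx : ‖x‖ < R) (hy : ‖y‖ < R) (hy0 : y ≠ 0) (hxy : x ≠ y) :
    fracGreen n s R x y =
      (Real.Gamma ((n : ℝ) / 2) / (2 ^ (2 * s) * Real.pi ^ (1 / (n : ℝ)) * Real.Gamma s ^ 2)) *
      (∫⁻ k in Ioo (max (‖x‖ ^ 2) (‖y‖ ^ 2)) (R ^ 2),
        ENNReal.ofReal (((k - ‖x‖ ^ 2) * (k - ‖y‖ ^ 2) / k) ^ (s - 1) *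
          (1 - ‖x‖ ^ 2 * ‖y‖ ^ 2 / k ^ 2) *
          (k + ‖x‖ ^ 2 * ‖y‖ ^ 2 / k - 2 * inner ℝ x y) ^ (-((n : ℝ) / 2)))).toReal := by
  have hd : 0 < ‖x - y‖ := norm_pos_iff.2 (sub_ne_zero.2 hxy)
  have hX : ‖x‖ ^ 2 < R ^ 2 := pow_lt_pow_left₀ hx (norm_nonneg x) two_ne_zero
  have hY : ‖y‖ ^ 2 < R ^ 2 := pow_lt_pow_left₀ hy (norm_nonneg y) two_ne_zero
  have hY0 : 0 < ‖y‖ ^ 2 := pow_pos (norm_pos_iff.2 hy0) 2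
  rw [fracGreen, mul_div_assoc]
  congr 1
  rw [integral_eq_lintegral_of_nonneg_ae]
  rotate_left
  · filter_upwards [ae_restrict_mem measurableSet_Ioo] with w hw
    have := hw.1
    simp only [Pi.zero_apply]
    positivity
  · exact Measurable.aestronglyMeasurable (by fun_prop)
  rw [neg_div, lintegral_Ioo_green_subst (sq_nonneg _) hY0 hX hY (by positivity),
    ENNReal.toReal_mul, ENNReal.toReal_ofReal (by positivity)]
  have e : ‖x - y‖ ^ ((n : ℝ) - 2 * s) = (‖x - y‖ ^ 2) ^ ((n : ℝ) / 2 - s) := by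
    rw [← Real.rpow_natCast, ← Real.rpow_mul hd.le]
    congr 1; push_cast; ring
  rw [e, mul_div_cancel_left₀ _ (by positivity)]
  congr 1
  refine setLIntegral_congr_fun measurableSet_Ioo fun k hk => ?_
  have hk0 : 0 < k := hY0.trans ((le_max_right _ _).trans_lt hk.1)
  have e2 : ‖x - y‖ ^ 2 + (k - ‖x‖ ^ 2) * (k - ‖y‖ ^ 2) / k =
      k + ‖x‖ ^ 2 * ‖y‖ ^ 2 / k - 2 * inner ℝ x y := by
    rw [norm_sub_sq_real]
    field_simp
    ring
  rw [e2]

theorem setIntegral_ball_fracGreen {n : ℕ} (hn : 1 ≤ n) {s R Q : ℝ} (hQ : Q ≤ R)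
    {x : EuclideanSpace ℝ (Fin n)} (hx : ‖x‖ < R)
    (hfin : ∫⁻ k in Ioo (‖x‖ ^ 2) (R ^ 2), ENNReal.ofReal ((k - ‖x‖ ^ 2) ^ (s - 1)) *
        ∫⁻ t in Ioo 0 (min 1 (Q / √k)),
          ENNReal.ofReal (t ^ (n - 1) * (1 - t ^ 2) ^ (s - 1)) ≠ ∞) :
    ∫ y in ball (0 : EuclideanSpace ℝ (Fin n)) Q, fracGreen n s R x y =
      (Real.Gamma ((n : ℝ) / 2) / (2 ^ (2 * s) * Real.pi ^ (1 / (n : ℝ)) * Real.Gamma s ^ 2)) *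
      ((volume : Measure (EuclideanSpace ℝ (Fin n))).toSphere univ).toReal *
      (∫⁻ k in Ioo (‖x‖ ^ 2) (R ^ 2), ENNReal.ofReal ((k - ‖x‖ ^ 2) ^ (s - 1)) *
        ∫⁻ t in Ioo 0 (min 1 (Q / √k)),
          ENNReal.ofReal (t ^ (n - 1) * (1 - t ^ 2) ^ (s - 1))).toReal := by
  have : Nontrivial (EuclideanSpace ℝ (Fin n)) :=
    Module.nontrivial_of_finrank_pos (R := ℝ) (by rw [finrank_euclideanSpace_fin]; omega)
  have hball := setLIntegral_ball_green (volume : Measure (EuclideanSpace ℝ (Fin n))) x Q (R ^ 2) s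
  rw [finrank_euclideanSpace_fin] at hball
  have hm := measurable_lintegral_Ioo_green x (R ^ 2) s ((n : ℝ) / 2)
  rw [mul_assoc, ← ENNReal.toReal_mul, ← hball, ← integral_toReal hm.aemeasurable,
    ← integral_const_mul]
  · refine setIntegral_congr_ae measurableSet_ball ?_
    have h0 : ∀ᵐ y : EuclideanSpace ℝ (Fin n), y ≠ 0 := by simp [ae_iff]
    have h1 : ∀ᵐ y : EuclideanSpace ℝ (Fin n), y ≠ x := by simp [ae_iff]
    filter_upwards [h0, h1] with y hy0 hyx hy
    exact fracGreen_eq hx ((mem_ball_zero_iff.1 hy).trans_le hQ) hy0 hyx.symm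
  · refine ae_lt_top hm ?_
    rw [hball]
    exact ENNReal.mul_ne_top (measure_ne_top _ _) hfin

end GreenPotential

/-- Under the scaling condition
`(F₁ + F₂)/F₂ ≥ (n/(2s)) (1+q)^n / ((1−q²)^s q^n)`, the Green-function representative
`u(x) = F₂ ∫_{B_R} G(x,y) dy − (F₁+F₂) ∫_{B_{qR}} G(x,y) dy` of the local Dirichlet
problem is radial and radially nondecreasing on `B_R(0)`: for all `x₁, x₂` with
`|x₁| ≤ |x₂| < R` one has `u(x₁) ≤ u(x₂)`. -/
theorem local_solution_radially_nondecreasing (n : ℕ) (hn : 2 ≤ n) (s q F₁ F₂ : ℝ)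
    (hs : s ∈ Set.Ioo (0:ℝ) 1) (hq : q ∈ Set.Ioo (0:ℝ) 1)
    (hF₁ : 0 < F₁) (hF₂ : 0 < F₂)
    (hF : (F₁ + F₂) / F₂ ≥ ((n : ℝ) / (2 * s)) * (1 + q) ^ n / ((1 - q ^ 2) ^ s * q ^ n))
    (R : ℝ) (hR : 0 < R) (x₁ x₂ : EuclideanSpace ℝ (Fin n))
    (h12 : ‖x₁‖ ≤ ‖x₂‖) (hx₂ : ‖x₂‖ < R) :
    F₂ * (∫ y in Metric.ball (0 : EuclideanSpace ℝ (Fin n)) R, fracGreen n s R x₁ y)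
        - (F₁ + F₂) *
          (∫ y in Metric.ball (0 : EuclideanSpace ℝ (Fin n)) (q * R), fracGreen n s R x₁ y)
      ≤ F₂ * (∫ y in Metric.ball (0 : EuclideanSpace ℝ (Fin n)) R, fracGreen n s R x₂ y)
        - (F₁ + F₂) *
          (∫ y in Metric.ball (0 : EuclideanSpace ℝ (Fin n)) (q * R), fracGreen n s R x₂ y) := by
  obtain ⟨hs0, hs1⟩ := hs
  obtain ⟨hq0, hq1⟩ := hq
  have hn0 : (0 : ℝ) < n := by exact_mod_cast (by omega : 0 < n)
  have hx₁ : ‖x₁‖ < R := h12.trans_lt hx₂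
  set h : ℝ → ENNReal := fun t => ENNReal.ofReal (t ^ (n - 1) * (1 - t ^ 2) ^ (s - 1)) with hh
  set B : ENNReal := ∫⁻ t in Set.Ioo (0 : ℝ) 1, h t with hB
  set β : ℝ → ENNReal := fun k => ∫⁻ t in Set.Ioo 0 (min 1 (q * R / √k)), h t with hβ
  have hBle : B ≤ ENNReal.ofReal (1 / (2 * s)) := lintegral_Ioo_beta_le hn hs0
  have hBtop : B ≠ ⊤ := ne_top_of_le_ne_top ENNReal.ofReal_ne_top hBle
  have hβB : ∀ k, β k ≤ B := fun k =>
    lintegral_mono_set (Set.Ioo_subset_Ioo_right (min_le_left _ _))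
  have hβq : ∀ k, 0 < k → k < R ^ 2 → ENNReal.ofReal (q ^ n / n) ≤ β k := fun k hk hkR => by
    refine (le_lintegral_Ioo_beta (by omega) hs1.le hq0.le hq1.le).trans
      (lintegral_mono_set (Set.Ioo_subset_Ioo_right (le_min hq1.le ?_)))
    rw [le_div_iff₀ (Real.sqrt_pos.2 hk)]
    exact mul_le_mul_of_nonneg_left (Real.sqrt_le_iff.2 ⟨hR.le, hkR.le⟩) hq0.le
  have hβanti : AntitoneOn β (Set.Ioi 0) := fun a ha b hb hab => by
    refine lintegral_mono_set (Set.Ioo_subset_Ioo_right (min_le_min_left _ ?_))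
    have : 0 < √a := Real.sqrt_pos.2 ha
    exact div_le_div_of_nonneg_left (by positivity) this (Real.sqrt_le_sqrt hab)
  have hscale : F₂ * (1 / (2 * s)) ≤ (F₁ + F₂) * (q ^ n / n) := by
    have h1 : (n : ℝ) / (2 * s) / q ^ n ≤
        (n : ℝ) / (2 * s) * (1 + q) ^ n / ((1 - q ^ 2) ^ s * q ^ n) := by
      have hq2 : 0 < 1 - q ^ 2 := by nlinarith
      have h2 : (1 - q ^ 2) ^ s ≤ 1 := Real.rpow_le_one hq2.le (by nlinarith) hs0.le
      have h3 : 1 ≤ (1 + q) ^ n := one_le_pow₀ (by linarith)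
      have h4 : 0 < (1 - q ^ 2) ^ s := Real.rpow_pos_of_pos hq2 s
      have h5 : 0 < q ^ n := pow_pos hq0 n
      apply div_le_div₀ (by positivity) (le_mul_of_one_le_right (by positivity) h3)
        (by positivity) (mul_le_of_le_one_left h5.le h2)
    have h2 := h1.trans hF
    have h5 : 0 < q ^ n := pow_pos hq0 n
    rw [div_div, div_le_div_iff₀ (by positivity) hF₂] at h2
    rw [mul_one_div, ← mul_div_assoc, div_le_div_iff₀ (by positivity) hn0]
    linarith
  have hγ : ∀ k, 0 < k → k < R ^ 2 →
      ENNReal.ofReal F₂ * B ≤ ENNReal.ofReal (F₁ + F₂) * β k := fun k hk hkR => by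
    calc _ ≤ ENNReal.ofReal F₂ * ENNReal.ofReal (1 / (2 * s)) := by gcongr
      _ ≤ ENNReal.ofReal (F₁ + F₂) * ENNReal.ofReal (q ^ n / n) := by
        rw [← ENNReal.ofReal_mul hF₂.le, ← ENNReal.ofReal_mul (by positivity)]
        exact ENNReal.ofReal_le_ofReal hscale
      _ ≤ _ := by gcongr; exact hβq k hk hkR
  set γ : ℝ → ENNReal := fun k => ENNReal.ofReal (F₁ + F₂) * β k - ENNReal.ofReal F₂ * B with hγd
  set C : ℝ := Real.Gamma ((n : ℝ) / 2) /
    (2 ^ (2 * s) * Real.pi ^ (1 / (n : ℝ)) * Real.Gamma s ^ 2) *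
      ((volume : Measure (EuclideanSpace ℝ (Fin n))).toSphere Set.univ).toReal with hC
  have hC0 : 0 ≤ C := by
    have := Real.Gamma_pos_of_pos (show (0 : ℝ) < n / 2 by positivity)
    have := Real.pi_pos
    positivity
  have key : ∀ x : EuclideanSpace ℝ (Fin n), ‖x‖ < R →
      (∫⁻ k in Set.Ioo (‖x‖ ^ 2) (R ^ 2), ENNReal.ofReal ((k - ‖x‖ ^ 2) ^ (s - 1)) * γ k ≠ ⊤) ∧
      F₂ * (∫ y in Metric.ball (0 : EuclideanSpace ℝ (Fin n)) R, fracGreen n s R x y)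
        - (F₁ + F₂) *
          (∫ y in Metric.ball (0 : EuclideanSpace ℝ (Fin n)) (q * R), fracGreen n s R x y) =
      -(C * (∫⁻ k in Set.Ioo (‖x‖ ^ 2) (R ^ 2),
        ENNReal.ofReal ((k - ‖x‖ ^ 2) ^ (s - 1)) * γ k).toReal) := by
    intro x hx
    have hX : ‖x‖ ^ 2 < R ^ 2 := pow_lt_pow_left₀ hx (norm_nonneg x) two_ne_zero
    have hpos : ∀ k ∈ Set.Ioo (‖x‖ ^ 2) (R ^ 2), 0 < k := fun k hk =>
      (sq_nonneg _).trans_lt hk.1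
    have hI : ∫⁻ k in Set.Ioo (‖x‖ ^ 2) (R ^ 2), ENNReal.ofReal ((k - ‖x‖ ^ 2) ^ (s - 1)) * B
        ≠ ⊤ := by
      rw [lintegral_Ioo_abel_rescale s hX, lintegral_mul_const' _ _ hBtop,
        lintegral_Ioo_rpow_sub_one zero_le_one hs0]
      exact ENNReal.mul_ne_top ENNReal.ofReal_ne_top
        (ENNReal.mul_ne_top ENNReal.ofReal_ne_top hBtop)
    have hV : ∫⁻ k in Set.Ioo (‖x‖ ^ 2) (R ^ 2), ENNReal.ofReal ((k - ‖x‖ ^ 2) ^ (s - 1)) * β k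
        ≠ ⊤ := by
      refine ne_top_of_le_ne_top hI (lintegral_mono fun k => ?_)
      gcongr
      exact hβB k
    have hR' : ∫⁻ k in Set.Ioo (‖x‖ ^ 2) (R ^ 2), ENNReal.ofReal ((k - ‖x‖ ^ 2) ^ (s - 1)) *
        ∫⁻ t in Set.Ioo 0 (min 1 (R / √k)), h t =
        ∫⁻ k in Set.Ioo (‖x‖ ^ 2) (R ^ 2), ENNReal.ofReal ((k - ‖x‖ ^ 2) ^ (s - 1)) * B := by
      refine setLIntegral_congr_fun measurableSet_Ioo fun k hk => ?_
      have : 1 ≤ R / √k := by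
        rw [le_div_iff₀ (Real.sqrt_pos.2 (hpos k hk)), one_mul]
        exact Real.sqrt_le_iff.2 ⟨hR.le, hk.2.le⟩
      rw [min_eq_left this]
    have hsum : ENNReal.ofReal (F₁ + F₂) * ∫⁻ k in Set.Ioo (‖x‖ ^ 2) (R ^ 2),
          ENNReal.ofReal ((k - ‖x‖ ^ 2) ^ (s - 1)) * β k =
        ENNReal.ofReal F₂ * (∫⁻ k in Set.Ioo (‖x‖ ^ 2) (R ^ 2),
          ENNReal.ofReal ((k - ‖x‖ ^ 2) ^ (s - 1)) * B) +
        ∫⁻ k in Set.Ioo (‖x‖ ^ 2) (R ^ 2), ENNReal.ofReal ((k - ‖x‖ ^ 2) ^ (s - 1)) * γ k := by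
      rw [← lintegral_const_mul' _ _ ENNReal.ofReal_ne_top,
        ← lintegral_const_mul' _ _ ENNReal.ofReal_ne_top, ← lintegral_add_left (by fun_prop)]
      refine setLIntegral_congr_fun measurableSet_Ioo fun k hk => ?_
      rw [mul_left_comm, mul_left_comm (ENNReal.ofReal F₂), ← mul_add, hγd,
        add_tsub_cancel_of_le (hγ k (hpos k hk) hk.2)]
    have hW : ∫⁻ k in Set.Ioo (‖x‖ ^ 2) (R ^ 2),
        ENNReal.ofReal ((k - ‖x‖ ^ 2) ^ (s - 1)) * γ k ≠ ⊤ :=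
      ne_top_of_le_ne_top (ENNReal.mul_ne_top ENNReal.ofReal_ne_top hV)
        (hsum ▸ le_add_self)
    refine ⟨hW, ?_⟩
    rw [setIntegral_ball_fracGreen (by omega) le_rfl hx (hR' ▸ hI),
      setIntegral_ball_fracGreen (by omega) (by nlinarith) hx hV, ← hC, hR']
    have := congrArg ENNReal.toReal hsum
    rw [ENNReal.toReal_add (ENNReal.mul_ne_top ENNReal.ofReal_ne_top hI) hW, ENNReal.toReal_mul,
      ENNReal.toReal_mul, ENNReal.toReal_ofReal (by positivity), ENNReal.toReal_ofReal hF₂.le]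
      at this
    linear_combination (-C) * this
  obtain ⟨hfin₁, h₁⟩ := key x₁ hx₁
  obtain ⟨-, h₂⟩ := key x₂ hx₂
  rw [h₁, h₂]
  refine neg_le_neg (mul_le_mul_of_nonneg_left (ENNReal.toReal_mono hfin₁ ?_) hC0)
  refine lintegral_Ioo_abel_anti hs0.le (pow_le_pow_left₀ (norm_nonneg _) h12 2)
    (pow_lt_pow_left₀ hx₂ (norm_nonneg _) two_ne_zero) fun a ha b hb hab => ?_
  have ha0 : 0 < a := (sq_nonneg _).trans_lt ha.1
  have := hβanti ha0 (ha0.trans_le hab) hab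
  simp only [hγd]
  gcongr
end

section
/- Fix y ∈ ℝⁿ with |y| < R. The map x ↦ Φ_{n,s}(x,y)/|x−y|^{n−2s} is differentiable at every x ∈ B_R(0) with x ≠ y, and its negative gradient equals −∇ₓ[Φ_{n,s}(x,y)/|x−y|^{n−2s}] = 2x (R² − |x|²)^{s−1} (R² − |y|²)^s R^{n−2s} / (R⁴ − 2R² x·y + |x|²|y|²)^{n/2} + ((x−y)/|x−y|²) · P_x(y), where P_x(y) := (n − 2s) Φ_{n,s}(x,y)/|x−y|^{n−2s} + 2 (R² − |x|²)^s (R² − |y|²)^s R^{n−2s} / (R⁴ − 2R² x·y + |x|²|y|²)^{n/2}. -/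
open MeasureTheory
open scoped RealInnerProductSpace

/-- The incomplete beta-type integral `t ↦ ∫₀ᵗ w^(s-1) (1+w)^a dw` has the expected derivative at
every `t > 0`. -/
theorem hasDerivAt_setIntegral_Ioo_rpow_mul_one_add_rpow {s : ℝ} (hs : 0 < s) (a : ℝ) {t : ℝ}
    (ht : 0 < t) :
    HasDerivAt (fun u : ℝ => ∫ w in Set.Ioo (0 : ℝ) u, w ^ (s - 1) * (1 + w) ^ a)
      (t ^ (s - 1) * (1 + t) ^ a) t := by
  have hint : IntervalIntegrable (fun w : ℝ => w ^ (s - 1) * (1 + w) ^ a) volume 0 t := by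
    refine (intervalIntegral.intervalIntegrable_rpow' (by linarith)).mul_continuousOn ?_
    rw [Set.uIcc_of_le ht.le]
    refine ContinuousOn.rpow_const (by fun_prop) fun w hw => Or.inl ?_
    linarith [hw.1]
  have hcont : ContinuousAt (fun w : ℝ => w ^ (s - 1) * (1 + w) ^ a) t := by
    refine ContinuousAt.mul (Real.continuousAt_rpow_const _ _ (Or.inl ht.ne')) ?_
    exact ContinuousAt.rpow_const (by fun_prop) (Or.inl (by linarith))
  have hmeas : Measurable (fun w : ℝ => w ^ (s - 1) * (1 + w) ^ a) := by fun_prop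
  refine (intervalIntegral.integral_hasDerivAt_right hint
    hmeas.stronglyMeasurable.stronglyMeasurableAtFilter hcont).congr_of_eventuallyEq ?_
  filter_upwards [lt_mem_nhds ht] with u hu
  rw [intervalIntegral.integral_of_le hu.le, integral_Ioc_eq_integral_Ioo]

/-- Chain rule for `z ↦ Φ ((R² - |z|²) B / (R² |z - y|²)) / |z - y|^m`. -/
theorem hasGradientAt_comp_div_norm_sub_rpow {E : Type*} [NormedAddCommGroup E]
    [InnerProductSpace ℝ E] [CompleteSpace E] {R B m : ℝ} (hR : R ≠ 0) {x y : E} (hxy : x ≠ y)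
    {Φ : ℝ → ℝ} {d : ℝ}
    (hΦ : HasDerivAt Φ d ((R ^ 2 - ‖x‖ ^ 2) * B / (R ^ 2 * ‖x - y‖ ^ 2))) :
    HasGradientAt
      (fun z : E => Φ ((R ^ 2 - ‖z‖ ^ 2) * B / (R ^ 2 * ‖z - y‖ ^ 2)) / ‖z - y‖ ^ m)
      (-((2 * (d * B / (R ^ 2 * ‖x - y‖ ^ 2) / ‖x - y‖ ^ m)) • x
        + ((m * Φ ((R ^ 2 - ‖x‖ ^ 2) * B / (R ^ 2 * ‖x - y‖ ^ 2)) / ‖x - y‖ ^ m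
            + 2 * ((R ^ 2 - ‖x‖ ^ 2) * (d * B / (R ^ 2 * ‖x - y‖ ^ 2) / ‖x - y‖ ^ m))) /
            ‖x - y‖ ^ 2) • (x - y))) x := by
  have hr : 0 < ‖x - y‖ := norm_pos_iff.2 (sub_ne_zero.2 hxy)
  have hnorm : HasFDerivAt (fun z : E => ‖z‖ ^ 2) (2 • innerSL ℝ x) x :=
    (hasStrictFDerivAt_norm_sq x).hasFDerivAt
  have hdist : HasFDerivAt (fun z : E => ‖z - y‖ ^ 2) (2 • innerSL ℝ (x - y)) x := by
    simpa using ((hasFDerivAt_id x).sub_const y).norm_sq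
  have hinv := (hasDerivAt_inv (pow_pos hr 2).ne').comp_hasFDerivAt x hdist
  have hζ := ((hnorm.const_sub (R ^ 2)).mul hinv).const_mul (B / R ^ 2)
  have hζeq : ∀ z : E, (R ^ 2 - ‖z‖ ^ 2) * B / (R ^ 2 * ‖z - y‖ ^ 2) =
      B / R ^ 2 * ((R ^ 2 - ‖z‖ ^ 2) * (‖z - y‖ ^ 2)⁻¹) := fun z => by
    rw [div_eq_mul_inv, mul_inv]; ring
  rw [hζeq x] at hΦ
  have hpow := (Real.hasDerivAt_rpow_const (p := -m / 2)
    (Or.inl (pow_pos hr 2).ne')).comp_hasFDerivAt x hdist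
  have hpoweq : ∀ z : E, (‖z - y‖ ^ 2) ^ (-m / 2) = (‖z - y‖ ^ m)⁻¹ := fun z => by
    rw [← Real.rpow_natCast, ← Real.rpow_mul (norm_nonneg _), ← Real.rpow_neg (norm_nonneg _)]
    congr 1; push_cast; ring
  have hmain := (hΦ.comp_hasFDerivAt x hζ).mul hpow
  rw [hasGradientAt_iff_hasFDerivAt]
  have hsub : (‖x - y‖ ^ 2) ^ (-m / 2 - 1) = (‖x - y‖ ^ m)⁻¹ / ‖x - y‖ ^ 2 := by
    rw [Real.rpow_sub_one (pow_pos hr 2).ne', hpoweq]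
  refine (hmain.congr_fderiv ?_).congr_of_eventuallyEq (.of_forall fun z => ?_)
  · ext v
    have hm : 0 < ‖x - y‖ ^ m := Real.rpow_pos_of_pos hr m
    rw [hζeq x]
    simp [hpoweq, hsub]
    generalize ‖x - y‖ ^ m = M at *
    generalize ⟪x - y, v⟫ = c
    generalize Φ _ = f
    field_simp
    ring
  · simp only [hζeq, div_eq_mul_inv _ (_ ^ m), ← hpoweq]
    rfl

/-- The derivative of the integral, rewritten through `R⁴ - 2R² x·y + |x|²|y|² = R²r² (1 + ζ)`. -/
theorem rpow_mul_one_add_rpow_div_eq {A B R r D s n : ℝ} (hA : 0 < A) (hB : 0 < B) (hR : 0 < R)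
    (hr : 0 < r) (hD : D = R ^ 2 * r ^ 2 + A * B) :
    (A * B / (R ^ 2 * r ^ 2)) ^ (s - 1) * (1 + A * B / (R ^ 2 * r ^ 2)) ^ (-n / 2) * B /
        (R ^ 2 * r ^ 2) / r ^ (n - 2 * s) =
      A ^ (s - 1) * B ^ s * R ^ (n - 2 * s) / D ^ (n / 2) := by
  have hAB : 0 < A * B := mul_pos hA hB
  have hRr : 0 < R ^ 2 * r ^ 2 := by positivity
  have hDpos : 0 < D := by rw [hD]; positivity
  have h1 : 1 + A * B / (R ^ 2 * r ^ 2) = D / (R ^ 2 * r ^ 2) := by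
    rw [hD]; field_simp
  have hRr' : ∀ a : ℝ, (R ^ 2 * r ^ 2) ^ a = R ^ (2 * a) * r ^ (2 * a) := fun a => by
    rw [Real.mul_rpow (by positivity) (by positivity), ← Real.rpow_natCast_mul hR.le,
      ← Real.rpow_natCast_mul hr.le]
    norm_num
  rw [h1, Real.div_rpow hAB.le hRr.le, Real.div_rpow hDpos.le hRr.le, hRr', hRr',
    Real.mul_rpow hA.le hB.le, neg_div, Real.rpow_neg hDpos.le,
    show 2 * -(n / 2) = -n by ring, show 2 * (s - 1) = 2 * s - 2 by ring,
    Real.rpow_neg hR.le, Real.rpow_neg hr.le, Real.rpow_sub hR, Real.rpow_sub hr,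
    Real.rpow_sub hR, Real.rpow_sub hr, Real.rpow_sub_one hB.ne', Real.rpow_two, Real.rpow_two]
  have := Real.rpow_pos_of_pos hDpos (n / 2)
  have := Real.rpow_pos_of_pos hR (2 * s)
  have := Real.rpow_pos_of_pos hr (2 * s)
  have := Real.rpow_pos_of_pos hR n
  have := Real.rpow_pos_of_pos hr n
  field_simp

/-- Fix `y ∈ ℝⁿ` with `|y| < R`. The map
`x ↦ Φ_{n,s}(x,y)/|x−y|^(n−2s)` is differentiable at every `x ∈ B_R(0)`, `x ≠ y`, with
`−∇ₓ[Φ/|x−y|^(n−2s)] = 2x(R²−|x|²)^(s−1)(R²−|y|²)^s R^(n−2s)/(R⁴−2R²x·y+|x|²|y|²)^(n/2)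
 + ((x−y)/|x−y|²)·P_x(y)` where
`P_x(y) = (n−2s)Φ/|x−y|^(n−2s) + 2(R²−|x|²)^s(R²−|y|²)^s R^(n−2s)/(R⁴−2R²x·y+|x|²|y|²)^(n/2)`. -/
theorem gradient_of_green_kernel (n : ℕ) (hn : 2 ≤ n) (s : ℝ) (hs : s ∈ Set.Ioo (0:ℝ) 1)
    (R : ℝ) (hR : 0 < R) (y : EuclideanSpace ℝ (Fin n)) (hy : ‖y‖ < R)
    (x : EuclideanSpace ℝ (Fin n)) (hx : ‖x‖ < R) (hxy : x ≠ y) :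
    HasGradientAt
      (fun z : EuclideanSpace ℝ (Fin n) =>
        (∫ w in Set.Ioo (0:ℝ)
            ((R ^ 2 - ‖z‖ ^ 2) * (R ^ 2 - ‖y‖ ^ 2) / (R ^ 2 * ‖z - y‖ ^ 2)),
            w ^ (s - 1) * (1 + w) ^ (-(n : ℝ) / 2)) / ‖z - y‖ ^ ((n : ℝ) - 2 * s))
      (-((2 * (R ^ 2 - ‖x‖ ^ 2) ^ (s - 1) * (R ^ 2 - ‖y‖ ^ 2) ^ s * R ^ ((n : ℝ) - 2 * s) /
            (R ^ 4 - 2 * R ^ 2 * ⟪x, y⟫ + ‖x‖ ^ 2 * ‖y‖ ^ 2) ^ ((n : ℝ) / 2)) • x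
        + ((((n : ℝ) - 2 * s) *
              (∫ w in Set.Ioo (0:ℝ)
                  ((R ^ 2 - ‖x‖ ^ 2) * (R ^ 2 - ‖y‖ ^ 2) / (R ^ 2 * ‖x - y‖ ^ 2)),
                  w ^ (s - 1) * (1 + w) ^ (-(n : ℝ) / 2)) / ‖x - y‖ ^ ((n : ℝ) - 2 * s)
            + 2 * (R ^ 2 - ‖x‖ ^ 2) ^ s * (R ^ 2 - ‖y‖ ^ 2) ^ s * R ^ ((n : ℝ) - 2 * s) /
              (R ^ 4 - 2 * R ^ 2 * ⟪x, y⟫ + ‖x‖ ^ 2 * ‖y‖ ^ 2) ^ ((n : ℝ) / 2)) /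
            ‖x - y‖ ^ 2) • (x - y)))
      x := by
  have hA : 0 < R ^ 2 - ‖x‖ ^ 2 := sub_pos.2 (pow_lt_pow_left₀ hx (norm_nonneg _) two_ne_zero)
  have hB : 0 < R ^ 2 - ‖y‖ ^ 2 := sub_pos.2 (pow_lt_pow_left₀ hy (norm_nonneg _) two_ne_zero)
  have hr : 0 < ‖x - y‖ := norm_pos_iff.2 (sub_ne_zero.2 hxy)
  have hD : R ^ 4 - 2 * R ^ 2 * ⟪x, y⟫ + ‖x‖ ^ 2 * ‖y‖ ^ 2 =
      R ^ 2 * ‖x - y‖ ^ 2 + (R ^ 2 - ‖x‖ ^ 2) * (R ^ 2 - ‖y‖ ^ 2) := by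
    rw [norm_sub_sq_real]; ring
  have hgrad := hasGradientAt_comp_div_norm_sub_rpow (m := (n : ℝ) - 2 * s) hR.ne' hxy
    (hasDerivAt_setIntegral_Ioo_rpow_mul_one_add_rpow hs.1 (-(n : ℝ) / 2)
      (t := (R ^ 2 - ‖x‖ ^ 2) * (R ^ 2 - ‖y‖ ^ 2) / (R ^ 2 * ‖x - y‖ ^ 2)) (by positivity))
  rw [rpow_mul_one_add_rpow_div_eq hA hB hR hr hD] at hgrad
  convert hgrad using 5
  · ring
  · rw [Real.rpow_sub_one hA.ne']
    field_simp
end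

section
/- Fix x ∈ ℝⁿ with |x| < R and define for y ∈ B_R(0)∖{x} the quantity P_x(y) := (n − 2s) Φ_{n,s}(x,y)/|x−y|^{n−2s} + 2 (R² − |x|²)^s (R² − |y|²)^s R^{n−2s} / (R⁴ − 2R² x·y + |x|²|y|²)^{n/2}. If y, y' ∈ B_R(0)∖{x} satisfy |y' − x| = |y − x| and |y'| ≤ |y|, then P_x(y') − P_x(y) = (n/|x−y|^{n−2s}) ∫_{ζ(x,y)}^{ζ(x,y')} w^{s−1}(1+w)^{−n/2−1} dw ≥ 0; in particular P_x(y') ≥ P_x(y). -/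
open MeasureTheory
open scoped RealInnerProductSpace

/-- `ζ(x,y) = (R² − |x|²)(R² − |y|²)/(R²|x−y|²)`. -/
noncomputable def zetaFn (n : ℕ) (R : ℝ) (x y : EuclideanSpace ℝ (Fin n)) : ℝ :=
  (R ^ 2 - ‖x‖ ^ 2) * (R ^ 2 - ‖y‖ ^ 2) / (R ^ 2 * ‖x - y‖ ^ 2)

/-- `P_x(y) = (n − 2s) Φ_{n,s}(x,y)/|x−y|^(n−2s)
 + 2(R² − |x|²)^s (R² − |y|²)^s R^(n−2s)/(R⁴ − 2R² x·y + |x|²|y|²)^(n/2)`, where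
`Φ_{n,s}(x,y) = ∫₀^{ζ(x,y)} w^(s−1)(1+w)^(−n/2) dw`. -/
noncomputable def Pfn (n : ℕ) (s R : ℝ) (x y : EuclideanSpace ℝ (Fin n)) : ℝ :=
  ((n : ℝ) - 2 * s) *
      (∫ w in Set.Ioo (0:ℝ) (zetaFn n R x y), w ^ (s - 1) * (1 + w) ^ (-(n : ℝ) / 2)) /
      ‖x - y‖ ^ ((n : ℝ) - 2 * s)
    + 2 * (R ^ 2 - ‖x‖ ^ 2) ^ s * (R ^ 2 - ‖y‖ ^ 2) ^ s * R ^ ((n : ℝ) - 2 * s) /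
      (R ^ 4 - 2 * R ^ 2 * ⟪x, y⟫ + ‖x‖ ^ 2 * ‖y‖ ^ 2) ^ ((n : ℝ) / 2)

open Set

theorem intervalIntegrable_rpow_mul_one_add_rpow {s b : ℝ} (hs : 0 < s) (hb : 0 ≤ b) (p : ℝ) :
    IntervalIntegrable (fun w : ℝ => w ^ (s - 1) * (1 + w) ^ p) volume 0 b := by
  have hpow : IntervalIntegrable (fun w : ℝ => w ^ (s - 1)) volume 0 b :=
    intervalIntegral.intervalIntegrable_rpow' (by linarith)
  refine hpow.mul_continuousOn ?_
  refine ContinuousOn.rpow_const (by fun_prop) fun w hw => Or.inl ?_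
  rw [uIcc_of_le hb] at hw
  linarith [hw.1]

theorem hasDerivAt_rpow_mul_one_add_rpow {w : ℝ} (hw : 0 < w) (s p : ℝ) :
    HasDerivAt (fun w : ℝ => w ^ s * (1 + w) ^ p)
      (s * (w ^ (s - 1) * (1 + w) ^ p) + p * (w ^ s * (1 + w) ^ (p - 1))) w := by
  have h₁ : HasDerivAt (fun w : ℝ => w ^ s) (s * w ^ (s - 1)) w :=
    Real.hasDerivAt_rpow_const (Or.inl hw.ne')
  have h₂ : HasDerivAt (fun w : ℝ => (1 + w) ^ p) (1 * p * (1 + w) ^ (p - 1)) w :=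
    ((hasDerivAt_id w).const_add 1).rpow_const (Or.inl (by simp only [id]; linarith))
  exact (h₁.mul h₂).congr_deriv (by ring)

/-- The increment of `(ν - 2s) ∫₀ᶻ w^(s-1) (1+w)^(-ν/2) dw + 2 z^s (1+z)^(-ν/2)`. -/
theorem kernel_profile_sub {s a b : ℝ} (ν : ℝ) (hs : 0 < s) (ha : 0 < a) (hab : a ≤ b) :
    ((ν - 2 * s) * (∫ w in Ioo 0 b, w ^ (s - 1) * (1 + w) ^ (-ν / 2))
          + 2 * (b ^ s * (1 + b) ^ (-ν / 2)))
        - ((ν - 2 * s) * (∫ w in Ioo 0 a, w ^ (s - 1) * (1 + w) ^ (-ν / 2))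
          + 2 * (a ^ s * (1 + a) ^ (-ν / 2)))
      = ν * ∫ w in Ioo a b, w ^ (s - 1) * (1 + w) ^ (-ν / 2 - 1) := by
  have hb : 0 < b := ha.trans_le hab
  have hI : ∀ p : ℝ, IntervalIntegrable (fun w : ℝ => w ^ (s - 1) * (1 + w) ^ p) volume a b :=
    fun p => (intervalIntegrable_rpow_mul_one_add_rpow hs ha.le p).symm.trans
      (intervalIntegrable_rpow_mul_one_add_rpow hs hb.le p)
  have hpos : ∀ w ∈ uIcc a b, 0 < w := fun w hw => by
    rw [uIcc_of_le hab] at hw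
    exact ha.trans_le hw.1
  have hderiv : ∀ w ∈ uIcc a b, HasDerivAt (fun w : ℝ => 2 * (w ^ s * (1 + w) ^ (-ν / 2)))
      (ν * (w ^ (s - 1) * (1 + w) ^ (-ν / 2 - 1))
        - (ν - 2 * s) * (w ^ (s - 1) * (1 + w) ^ (-ν / 2))) w := fun w hw => by
    have hw₀ := hpos w hw
    refine ((hasDerivAt_rpow_mul_one_add_rpow hw₀ s (-ν / 2)).const_mul 2).congr_deriv ?_
    have h₁ : w ^ s = w ^ (s - 1) * w := by
      rw [← Real.rpow_add_one hw₀.ne', sub_add_cancel]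
    have h₂ : (1 + w) ^ (-ν / 2) = (1 + w) ^ (-ν / 2 - 1) * (1 + w) := by
      rw [← Real.rpow_add_one (by linarith), sub_add_cancel]
    rw [h₁, h₂]
    ring
  have hFTC := intervalIntegral.integral_eq_sub_of_hasDerivAt hderiv
    (((hI _).const_mul _).sub ((hI _).const_mul _))
  rw [intervalIntegral.integral_sub ((hI _).const_mul _) ((hI _).const_mul _),
    intervalIntegral.integral_const_mul, intervalIntegral.integral_const_mul] at hFTC
  have hsub := intervalIntegral.integral_interval_sub_left
    (intervalIntegrable_rpow_mul_one_add_rpow hs hb.le (-ν / 2))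
    (intervalIntegrable_rpow_mul_one_add_rpow hs ha.le (-ν / 2))
  simp only [← integral_Ioc_eq_integral_Ioo, ← intervalIntegral.integral_of_le hab,
    ← intervalIntegral.integral_of_le ha.le, ← intervalIntegral.integral_of_le hb.le]
  linear_combination -hFTC + (ν - 2 * s) * hsub

theorem zetaFn_pos {n : ℕ} {R : ℝ} {x y : EuclideanSpace ℝ (Fin n)} (hx : ‖x‖ < R)
    (hy : ‖y‖ < R) (hyx : y ≠ x) : 0 < zetaFn n R x y := by
  have hR : 0 < R := (norm_nonneg x).trans_lt hx
  have hd : 0 < ‖x - y‖ := norm_pos_iff.2 (sub_ne_zero.2 hyx.symm)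
  have hA : 0 < R ^ 2 - ‖x‖ ^ 2 := by nlinarith [norm_nonneg x]
  have hB : 0 < R ^ 2 - ‖y‖ ^ 2 := by nlinarith [norm_nonneg y]
  unfold zetaFn
  positivity

theorem Pfn_eq_div {n : ℕ} {s R : ℝ} {x y : EuclideanSpace ℝ (Fin n)} (hx : ‖x‖ < R)
    (hy : ‖y‖ < R) (hyx : y ≠ x) :
    Pfn n s R x y =
      (((n : ℝ) - 2 * s) *
          (∫ w in Ioo 0 (zetaFn n R x y), w ^ (s - 1) * (1 + w) ^ (-(n : ℝ) / 2))
        + 2 * (zetaFn n R x y ^ s * (1 + zetaFn n R x y) ^ (-(n : ℝ) / 2)))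
        / ‖x - y‖ ^ ((n : ℝ) - 2 * s) := by
  have hR : 0 < R := (norm_nonneg x).trans_lt hx
  have hd : 0 < ‖x - y‖ := norm_pos_iff.2 (sub_ne_zero.2 hyx.symm)
  have hA : 0 < R ^ 2 - ‖x‖ ^ 2 := by nlinarith [norm_nonneg x]
  have hB : 0 < R ^ 2 - ‖y‖ ^ 2 := by nlinarith [norm_nonneg y]
  have hζ := zetaFn_pos hx hy hyx
  have hζ₁ : (R ^ 2 - ‖x‖ ^ 2) * (R ^ 2 - ‖y‖ ^ 2) = (R * ‖x - y‖) ^ (2 : ℝ) * zetaFn n R x y := by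
    rw [Real.rpow_two, zetaFn]
    field_simp
  have hζ₂ : R ^ 4 - 2 * R ^ 2 * ⟪x, y⟫ + ‖x‖ ^ 2 * ‖y‖ ^ 2
      = (R * ‖x - y‖) ^ (2 : ℝ) * (1 + zetaFn n R x y) := by
    rw [mul_add, ← hζ₁, Real.rpow_two, mul_pow, norm_sub_sq_real]
    ring
  have hnum : (R ^ 2 - ‖x‖ ^ 2) ^ s * (R ^ 2 - ‖y‖ ^ 2) ^ s
      = R ^ (2 * s) * ‖x - y‖ ^ (2 * s) * zetaFn n R x y ^ s := by
    rw [← Real.mul_rpow hA.le hB.le, hζ₁, Real.mul_rpow (by positivity) hζ.le,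
      ← Real.rpow_mul (by positivity), Real.mul_rpow hR.le hd.le]
  have hden : (R ^ 4 - 2 * R ^ 2 * ⟪x, y⟫ + ‖x‖ ^ 2 * ‖y‖ ^ 2) ^ ((n : ℝ) / 2)
      = R ^ (n : ℝ) * ‖x - y‖ ^ (n : ℝ) * (1 + zetaFn n R x y) ^ ((n : ℝ) / 2) := by
    rw [hζ₂, Real.mul_rpow (by positivity) (by positivity), ← Real.rpow_mul (by positivity),
      mul_div_cancel₀ _ (two_ne_zero' ℝ), Real.mul_rpow hR.le hd.le]
  rw [Pfn, mul_assoc 2, hnum, hden, add_div, neg_div, Real.rpow_neg (by positivity),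
    Real.rpow_sub hR, Real.rpow_sub hd]
  congr 1
  field_simp

theorem zetaFn_le_zetaFn {n : ℕ} {R : ℝ} {x y y' : EuclideanSpace ℝ (Fin n)} (hx : ‖x‖ < R)
    (hdist : ‖x - y'‖ = ‖x - y‖) (hnorm : ‖y'‖ ≤ ‖y‖) :
    zetaFn n R x y ≤ zetaFn n R x y' := by
  have hA : 0 ≤ R ^ 2 - ‖x‖ ^ 2 := by nlinarith [norm_nonneg x]
  rw [zetaFn, zetaFn, hdist]
  gcongr

/-- Fix `x` with `|x| < R`. If `y, y' ∈ B_R(0) ∖ {x}` satisfy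
`|y' − x| = |y − x|` and `|y'| ≤ |y|`, then
`P_x(y') − P_x(y) = (n/|x−y|^(n−2s)) ∫_{ζ(x,y)}^{ζ(x,y')} w^(s−1)(1+w)^(−n/2−1) dw ≥ 0`;
in particular `P_x(y') ≥ P_x(y)`. -/
theorem P_monotone_under_reflection (n : ℕ) (hn : 2 ≤ n) (s : ℝ)
    (hs : s ∈ Set.Ioo (0:ℝ) 1) (R : ℝ) (hR : 0 < R)
    (x y y' : EuclideanSpace ℝ (Fin n)) (hx : ‖x‖ < R)
    (hy : ‖y‖ < R) (hy' : ‖y'‖ < R) (hyx : y ≠ x) (hy'x : y' ≠ x)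
    (hdist : ‖y' - x‖ = ‖y - x‖) (hnorm : ‖y'‖ ≤ ‖y‖) :
    Pfn n s R x y' - Pfn n s R x y
        = ((n : ℝ) / ‖x - y‖ ^ ((n : ℝ) - 2 * s)) *
            (∫ w in Set.Ioo (zetaFn n R x y) (zetaFn n R x y'),
              w ^ (s - 1) * (1 + w) ^ (-(n : ℝ) / 2 - 1)) ∧
      Pfn n s R x y ≤ Pfn n s R x y' := by
  have hdist' : ‖x - y'‖ = ‖x - y‖ := by rw [norm_sub_rev, hdist, norm_sub_rev]
  have hζ := zetaFn_pos hx hy hyx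
  have hle := zetaFn_le_zetaFn hx hdist' hnorm
  have hsub : Pfn n s R x y' - Pfn n s R x y
      = ((n : ℝ) / ‖x - y‖ ^ ((n : ℝ) - 2 * s)) *
          (∫ w in Set.Ioo (zetaFn n R x y) (zetaFn n R x y'),
            w ^ (s - 1) * (1 + w) ^ (-(n : ℝ) / 2 - 1)) := by
    rw [Pfn_eq_div hx hy hyx, Pfn_eq_div hx hy' hy'x, hdist', ← sub_div,
      kernel_profile_sub (n : ℝ) hs.1 hζ hle]
    ring
  refine ⟨hsub, sub_nonneg.1 ?_⟩
  rw [hsub]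
  refine mul_nonneg (by positivity) (setIntegral_nonneg measurableSet_Ioo fun w hw => ?_)
  have hw₀ : 0 < w := hζ.trans hw.1
  positivity
end

section
/- Let n ≥ 1 be an integer, s ∈ (0,1) and α ∈ (0, 2s). There exist constants C₀, C₁, C₂ > 0 depending only on n, s, α with the following property: for all h, d, l > 0 and every Λ : ℤⁿ → ℝ satisfying |Λ(a) − Λ(b)| ≤ 2h ‖a − b‖₁^α for all a, b ∈ ℤⁿ, there exists a smooth function u : ℝⁿ → ℝ such that (i) u(x) = Λ(a) whenever x ∈ Q̂_a for some a ∈ ℤⁿ, (ii) ‖D²u‖_{L^∞(ℝⁿ)} ≤ C₀ h/d², and (iii) for every x ∈ ℝⁿ, ∫_{ℝⁿ} |u(x+y) + u(x−y) − 2u(x)| / |y|^{n+2s} dy ≤ C₁ (d+l)^{2−2s} h/d² + C₂ h/(d+l)^{2s}. -/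
open MeasureTheory

section SecondDifference

variable {E : Type*} [NormedAddCommGroup E] [NormedSpace ℝ E]

lemma abs_second_difference_le {u : E → ℝ} (hu : ContDiff ℝ 2 u) {K : ℝ}
    (hK : ∀ x, ‖iteratedFDeriv ℝ 2 u x‖ ≤ K) (x y : E) :
    |u (x + y) + u (x - y) - 2 * u x| ≤ K * ‖y‖ ^ 2 := by
  have hdu : Differentiable ℝ u := hu.differentiable (by norm_num)
  have hddu : Differentiable ℝ (fderiv ℝ u) :=
    (hu.fderiv_right (m := 1) (by norm_num)).differentiable (by norm_num)
  have hlip : ∀ a b : E, ‖fderiv ℝ u b - fderiv ℝ u a‖ ≤ K * ‖b - a‖ := fun a b =>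
    convex_univ.norm_image_sub_le_of_norm_fderiv_le (𝕜 := ℝ) (fun z _ => hddu z)
      (fun z _ => by
        rw [← norm_iteratedFDeriv_one, norm_iteratedFDeriv_fderiv]
        exact hK z) (Set.mem_univ a) (Set.mem_univ b)
  have hφ : ∀ z, HasFDerivAt (fun z => u (z + y) - u z)
      (fderiv ℝ u (z + y) - fderiv ℝ u z) z := fun z =>
    ((hasFDerivAt_comp_add_right y).2 (hdu (z + y)).hasFDerivAt).sub (hdu z).hasFDerivAt
  have key := convex_univ.norm_image_sub_le_of_norm_fderiv_le (𝕜 := ℝ) (C := K * ‖y‖)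
    (f := fun z => u (z + y) - u z) (x := x - y) (y := x)
    (fun z _ => (hφ z).differentiableAt)
    (fun z _ => by
      rw [(hφ z).fderiv]
      simpa using hlip z (z + y)) (Set.mem_univ _) (Set.mem_univ _)
  rw [Real.norm_eq_abs, sub_add_cancel, sub_sub_cancel] at key
  calc |u (x + y) + u (x - y) - 2 * u x| = |u (x + y) - u x - (u x - u (x - y))| := by ring_nf
    _ ≤ K * ‖y‖ * ‖y‖ := key
    _ = K * ‖y‖ ^ 2 := by ring

end SecondDifference

section Convolution

open scoped Convolution

variable {E F F' : Type*} [NormedAddCommGroup E] [NormedAddCommGroup F] [NormedSpace ℝ F]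
  [NormedAddCommGroup F'] [NormedSpace ℝ F'] [MeasurableSpace E] [BorelSpace E] {μ : Measure E}

lemma exists_norm_convolution_le [IsFiniteMeasureOnCompacts μ] (B : F →L[ℝ] ℝ →L[ℝ] F')
    {k : E → F} (hc : HasCompactSupport k) (hk : Continuous k) :
    ∃ C : ℝ, 0 < C ∧ ∀ (g : E → ℝ) (x : E) (ε : ℝ), 0 ≤ ε →
      (∀ t ∈ tsupport k, |g (x - t)| ≤ ε) → ‖(k ⋆[B, μ] g) x‖ ≤ C * ε := by
  have hint : Integrable (fun t => ‖k t‖) μ :=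
    hk.norm.integrable_of_hasCompactSupport hc.norm
  have hI : 0 ≤ ∫ t, ‖k t‖ ∂μ := integral_nonneg fun _ => norm_nonneg _
  refine ⟨‖B‖ * (∫ t, ‖k t‖ ∂μ) + 1, by positivity, fun g x ε hε hg => ?_⟩
  calc ‖(k ⋆[B, μ] g) x‖ ≤ ∫ t, ‖B‖ * ‖k t‖ * ε ∂μ := by
        refine norm_integral_le_of_norm_le ((hint.const_mul _).mul_const _)
          (Filter.Eventually.of_forall fun t => ?_)
        by_cases ht : t ∈ tsupport k
        · exact (B.le_opNorm₂ _ _).trans (by gcongr; exact hg t ht)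
        · simp [image_eq_zero_of_notMem_tsupport ht]
    _ = ‖B‖ * (∫ t, ‖k t‖ ∂μ) * ε := by rw [integral_mul_const, integral_const_mul]
    _ ≤ _ := by gcongr; linarith

variable [NormedSpace ℝ E] [FiniteDimensional ℝ E] [μ.IsAddHaarMeasure]

lemma exists_norm_fderiv_convolution_le (B : F →L[ℝ] ℝ →L[ℝ] F') {k : E → F}
    (hc : HasCompactSupport k) (hk : ContDiff ℝ 1 k) :
    ∃ C : ℝ, 0 < C ∧ ∀ (g : E → ℝ) (x : E) (ε : ℝ), LocallyIntegrable g μ → 0 ≤ ε →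
      (∀ t ∈ tsupport k, |g (x - t)| ≤ ε) → ‖fderiv ℝ (k ⋆[B, μ] g) x‖ ≤ C * ε := by
  obtain ⟨C, hC, H⟩ := exists_norm_convolution_le (μ := μ) (B.precompL E) (hc.fderiv ℝ)
    (hk.continuous_fderiv one_ne_zero)
  refine ⟨C, hC, fun g x ε hg hε hgε => ?_⟩
  rw [(hc.hasFDerivAt_convolution_left B hk hg x).fderiv]
  exact H g x ε hε fun t ht => hgε t (tsupport_fderiv_subset ℝ ht)

variable (μ) in
lemma exists_norm_iteratedFDeriv_two_convolution_le {η : E → ℝ} (hc : HasCompactSupport η)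
    (hη : ContDiff ℝ 2 η) :
    ∃ C : ℝ, 0 < C ∧ ∀ (g : E → ℝ) (x : E) (ε : ℝ), LocallyIntegrable g μ → 0 ≤ ε →
      (∀ t ∈ tsupport η, |g (x - t)| ≤ ε) →
      ‖iteratedFDeriv ℝ 2 (η ⋆[ContinuousLinearMap.lsmul ℝ ℝ, μ] g) x‖ ≤ C * ε := by
  have hη' : ContDiff ℝ 1 (fderiv ℝ η) := hη.fderiv_right (by norm_num)
  obtain ⟨C, hC, H⟩ := exists_norm_fderiv_convolution_le (μ := μ)
    ((ContinuousLinearMap.lsmul ℝ ℝ).precompL E) (hc.fderiv ℝ) hη'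
  refine ⟨C, hC, fun g x ε hg hε hgε => ?_⟩
  have h1 : fderiv ℝ (η ⋆[ContinuousLinearMap.lsmul ℝ ℝ, μ] g) =
      (fderiv ℝ η ⋆[(ContinuousLinearMap.lsmul ℝ ℝ).precompL E, μ] g) :=
    funext fun z => (hc.hasFDerivAt_convolution_left _ (hη.of_le (by norm_num)) hg z).fderiv
  rw [← norm_iteratedFDeriv_fderiv, norm_iteratedFDeriv_one, h1]
  exact H g x ε hg hε fun t ht => hgε t (tsupport_fderiv_subset ℝ ht)

end Convolution

section RadialIntegral

variable {n : ℕ}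

lemma integrable_indicator_norm_rpow (hn : 1 ≤ n) {S : Set ℝ} (hS : MeasurableSet S) {q : ℝ}
    (h : IntegrableOn (fun t : ℝ => t ^ (n - 1 + q)) (S ∩ Set.Ioi 0)) :
    Integrable (fun z : EuclideanSpace ℝ (Fin n) => S.indicator (fun t => t ^ q) ‖z‖) := by
  have : Nonempty (Fin n) := ⟨⟨0, hn⟩⟩
  rw [integrable_fun_norm_addHaar volume (f := S.indicator fun t => t ^ q)]
  have h' : IntegrableOn (S.indicator fun t : ℝ => t ^ (n - 1 + q)) (Set.Ioi 0) := by
    rwa [IntegrableOn, integrable_indicator_iff hS, IntegrableOn, Measure.restrict_restrict hS]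
  refine h'.congr_fun (fun t ht => ?_) measurableSet_Ioi
  by_cases hts : t ∈ S
  · simp only [Set.indicator_of_mem hts, smul_eq_mul, finrank_euclideanSpace, Fintype.card_fin]
    rw [Real.rpow_add ht, ← Real.rpow_natCast, Nat.cast_sub hn, Nat.cast_one]
  · simp [Set.indicator_of_notMem hts]

lemma integral_div_norm_rpow_le (hn : 1 ≤ n) {s α : ℝ} (hs : s < 1) (hα : α < 2 * s)
    {L K M : ℝ} (hL : 0 < L) (hK : 0 ≤ K) (hM : 0 ≤ M) {F : EuclideanSpace ℝ (Fin n) → ℝ}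
    (hF : ∀ y, 0 ≤ F y) (hnear : ∀ y, F y ≤ K * ‖y‖ ^ 2)
    (hfar : ∀ y, L ≤ ‖y‖ → F y ≤ M * (‖y‖ / L) ^ α) :
    ∫ y, F y / ‖y‖ ^ ((n : ℝ) + 2 * s) ≤
      K * L ^ (2 - 2 * s) * (∫ z : EuclideanSpace ℝ (Fin n),
        (Set.Iic 1).indicator (fun t : ℝ => t ^ (2 - (n + 2 * s))) ‖z‖) +
      M / L ^ (2 * s) * (∫ z : EuclideanSpace ℝ (Fin n),
        (Set.Ioi 1).indicator (fun t : ℝ => t ^ (α - (n + 2 * s))) ‖z‖) := by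
  set p : ℝ := n + 2 * s with hp
  set G₁ : EuclideanSpace ℝ (Fin n) → ℝ := fun z =>
    (Set.Iic 1).indicator (fun t : ℝ => t ^ (2 - p)) ‖z‖ with hG₁
  set G₂ : EuclideanSpace ℝ (Fin n) → ℝ := fun z =>
    (Set.Ioi 1).indicator (fun t : ℝ => t ^ (α - p)) ‖z‖ with hG₂
  have hG₁i : Integrable G₁ := by
    refine integrable_indicator_norm_rpow hn measurableSet_Iic ?_
    rw [Set.inter_comm, Set.Ioi_inter_Iic, integrableOn_Ioc_iff_integrableOn_Ioo,
      intervalIntegral.integrableOn_Ioo_rpow_iff one_pos]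
    linarith
  have hG₂i : Integrable G₂ := by
    refine integrable_indicator_norm_rpow hn measurableSet_Ioi ?_
    rw [Set.Ioi_inter_Ioi, max_eq_left zero_le_one, integrableOn_Ioi_rpow_iff one_pos]
    linarith
  have hG₁0 : ∀ z, 0 ≤ G₁ z := fun z =>
    Set.indicator_apply_nonneg fun _ => Real.rpow_nonneg (norm_nonneg _) _
  have hG₂0 : ∀ z, 0 ≤ G₂ z := fun z =>
    Set.indicator_apply_nonneg fun _ => Real.rpow_nonneg (norm_nonneg _) _
  set G : EuclideanSpace ℝ (Fin n) → ℝ := fun z =>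
    K * L ^ 2 / L ^ p * G₁ z + M / L ^ p * G₂ z with hG
  have hGi : Integrable G := (hG₁i.const_mul _).add (hG₂i.const_mul _)
  have hbound : ∀ y, F y / ‖y‖ ^ p ≤ G (L⁻¹ • y) := by
    intro y
    obtain ⟨z, rfl⟩ : ∃ z, y = L • z := ⟨L⁻¹ • y, by rw [smul_inv_smul₀ hL.ne']⟩
    rw [inv_smul_smul₀ hL.ne']
    have hnz : ‖L • z‖ = L * ‖z‖ := by rw [norm_smul, Real.norm_of_nonneg hL.le]
    have hG1 := hG₁0 z
    have hG2 := hG₂0 z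
    rcases (norm_nonneg z).eq_or_lt with hz | hz
    · have : F (L • z) = 0 := by
        refine le_antisymm ((hnear _).trans ?_) (hF _)
        simp [hnz, ← hz]
      rw [this, zero_div]
      positivity
    have hrp : (L * ‖z‖) ^ p = L ^ p * ‖z‖ ^ p := Real.mul_rpow hL.le hz.le
    rcases le_or_gt ‖z‖ 1 with h1 | h1
    · have hG₁z : G₁ z = ‖z‖ ^ 2 / ‖z‖ ^ p := by
        rw [hG₁]
        simp only
        rw [Set.indicator_of_mem (Set.mem_Iic.2 h1), Real.rpow_sub hz, Real.rpow_two]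
      calc F (L • z) / ‖L • z‖ ^ p ≤ K * ‖L • z‖ ^ 2 / ‖L • z‖ ^ p := by
            gcongr
            exact hnear _
        _ = K * L ^ 2 / L ^ p * G₁ z := by
            rw [hnz, hrp, hG₁z, mul_pow]
            field_simp
        _ ≤ G z := le_add_of_nonneg_right (by positivity)
    · have hG₂z : G₂ z = ‖z‖ ^ α / ‖z‖ ^ p := by
        rw [hG₂]
        simp only
        rw [Set.indicator_of_mem (Set.mem_Ioi.2 h1), Real.rpow_sub hz]
      calc F (L • z) / ‖L • z‖ ^ p ≤ M * (‖L • z‖ / L) ^ α / ‖L • z‖ ^ p := by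
            gcongr
            exact hfar _ (by rw [hnz]; nlinarith)
        _ = M / L ^ p * G₂ z := by
            rw [hnz, hrp, hG₂z, mul_div_cancel_left₀ _ hL.ne']
            field_simp
        _ ≤ G z := le_add_of_nonneg_left (by positivity)
  calc ∫ y, F y / ‖y‖ ^ p ≤ ∫ y, G (L⁻¹ • y) :=
        integral_mono_of_nonneg
          (Filter.Eventually.of_forall fun y => div_nonneg (hF y) (by positivity))
          (hGi.comp_smul (inv_ne_zero hL.ne')) (Filter.Eventually.of_forall hbound)
    _ = L ^ n * (K * L ^ 2 / L ^ p * (∫ z, G₁ z) + M / L ^ p * ∫ z, G₂ z) := by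
        rw [Measure.integral_comp_inv_smul, finrank_euclideanSpace, Fintype.card_fin,
          abs_of_pos (by positivity), smul_eq_mul, hG,
          integral_add (hG₁i.const_mul _) (hG₂i.const_mul _), integral_const_mul,
          integral_const_mul]
    _ = _ := by
        rw [Real.rpow_sub hL, Real.rpow_two, hp, Real.rpow_add hL, Real.rpow_natCast]
        field_simp

end RadialIntegral

section LatticeStep

variable {n : ℕ}

/-- The piecewise constant extension of `Λ`, in coordinates where the lattice has spacing
`r⁻¹`. -/
noncomputable def latticeStep (r : ℝ) (Λ : (Fin n → ℤ) → ℝ) (y : EuclideanSpace ℝ (Fin n)) : ℝ :=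
  Λ fun i => ⌊r * y i + 1 / 2⌋

lemma abs_floor_sub_floor_le (a b : ℝ) : |(⌊a⌋ : ℝ) - ⌊b⌋| ≤ |a - b| + 1 := by
  have h := Int.abs_sub_lt_one_of_floor_eq_floor (a := Int.fract a) (b := Int.fract b) (by simp)
  calc |(⌊a⌋ : ℝ) - ⌊b⌋| = |(a - b) - (Int.fract a - Int.fract b)| := by
        rw [Int.fract, Int.fract]; ring_nf
    _ ≤ |a - b| + |Int.fract a - Int.fract b| := abs_sub _ _
    _ ≤ |a - b| + 1 := by gcongr

lemma measurable_latticeStep (r : ℝ) (Λ : (Fin n → ℤ) → ℝ) : Measurable (latticeStep r Λ) := by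
  refine (Measurable.of_discrete (f := Λ)).comp (measurable_pi_lambda _ fun i => ?_)
  refine Int.measurable_floor.comp ?_
  fun_prop

lemma latticeStep_eq {r : ℝ} {Λ : (Fin n → ℤ) → ℝ} {y : EuclideanSpace ℝ (Fin n)}
    {a : Fin n → ℤ} (h : ∀ i, |r * y i - a i| < 1 / 2) : latticeStep r Λ y = Λ a := by
  unfold latticeStep
  congr 1
  ext i
  have := abs_lt.1 (h i)
  rw [Int.floor_eq_iff]
  constructor <;> linarith

variable {r h α : ℝ} {Λ : (Fin n → ℤ) → ℝ}

lemma abs_latticeStep_sub_le (hr : 0 ≤ r) (hh : 0 ≤ h) (hα : 0 ≤ α)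
    (hΛ : ∀ a b : Fin n → ℤ, |Λ a - Λ b| ≤ 2 * h * ((∑ i, |(a i : ℝ) - (b i : ℝ)|) ^ α))
    (p q : EuclideanSpace ℝ (Fin n)) :
    |latticeStep r Λ p - latticeStep r Λ q| ≤ 2 * h * (n * (r * ‖p - q‖ + 1)) ^ α := by
  refine (hΛ _ _).trans ?_
  have hsum : ∑ i, |((⌊r * p i + 1 / 2⌋ : ℤ) : ℝ) - (⌊r * q i + 1 / 2⌋ : ℤ)| ≤
      n * (r * ‖p - q‖ + 1) := by
    calc _ ≤ ∑ _i : Fin n, (r * ‖p - q‖ + 1) := by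
          refine Finset.sum_le_sum fun i _ => (abs_floor_sub_floor_le _ _).trans ?_
          have hi : |p i - q i| ≤ ‖p - q‖ := PiLp.norm_apply_le (p - q) i
          have : r * p i + 1 / 2 - (r * q i + 1 / 2) = r * (p i - q i) := by ring
          rw [this, abs_mul, abs_of_nonneg hr]
          gcongr
      _ = _ := by simp [mul_add]
  gcongr

lemma abs_latticeStep_sub_le_of_mul_norm_le (hr : 0 ≤ r) (hh : 0 ≤ h) (hα : 0 ≤ α)
    (hΛ : ∀ a b : Fin n → ℤ, |Λ a - Λ b| ≤ 2 * h * ((∑ i, |(a i : ℝ) - (b i : ℝ)|) ^ α))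
    {p q : EuclideanSpace ℝ (Fin n)} {ρ : ℝ} (hρ : 1 ≤ ρ) (hpq : r * ‖p - q‖ ≤ ρ) :
    |latticeStep r Λ p - latticeStep r Λ q| ≤ 2 * h * (2 * n) ^ α * ρ ^ α := by
  refine (abs_latticeStep_sub_le hr hh hα hΛ p q).trans ?_
  rw [mul_assoc _ _ (ρ ^ α), ← Real.mul_rpow (by positivity) (by positivity)]
  have : n * (r * ‖p - q‖ + 1) ≤ 2 * n * ρ := by
    have : (n : ℝ) * (r * ‖p - q‖ + 1) ≤ n * (2 * ρ) := by gcongr; linarith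
    linarith
  gcongr

lemma locallyIntegrable_latticeStep (hr : 0 ≤ r) (hh : 0 ≤ h) (hα : 0 ≤ α)
    (hΛ : ∀ a b : Fin n → ℤ, |Λ a - Λ b| ≤ 2 * h * ((∑ i, |(a i : ℝ) - (b i : ℝ)|) ^ α)) :
    LocallyIntegrable (latticeStep r Λ) := by
  have hcont : Continuous fun y : EuclideanSpace ℝ (Fin n) =>
      |latticeStep r Λ 0| + 2 * h * (n * (r * ‖y‖ + 1)) ^ α := by
    refine continuous_const.add (continuous_const.mul (Continuous.rpow_const ?_ fun _ => .inr hα))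
    fun_prop
  refine hcont.locallyIntegrable.mono (measurable_latticeStep r Λ).aestronglyMeasurable
    (Filter.Eventually.of_forall fun y => ?_)
  have h1 := abs_latticeStep_sub_le hr hh hα hΛ y 0
  rw [sub_zero] at h1
  rw [Real.norm_eq_abs]
  refine le_trans ?_ (le_abs_self _)
  linarith [abs_sub_abs_le_abs_sub (latticeStep r Λ y) (latticeStep r Λ 0)]

end LatticeStep

section Mollification

open scoped Convolution

/-- A fixed smooth bump function on `ℝⁿ` supported in the ball of radius `1 / 2`. -/
noncomputable def halfBump (n : ℕ) : ContDiffBump (0 : EuclideanSpace ℝ (Fin n)) :=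
  ⟨1 / 4, 1 / 2, by norm_num, by norm_num⟩

variable {n : ℕ}

/-- The mollification of a function at unit scale. -/
noncomputable def mollify (v : EuclideanSpace ℝ (Fin n) → ℝ) : EuclideanSpace ℝ (Fin n) → ℝ :=
  (halfBump n).normed volume ⋆[ContinuousLinearMap.lsmul ℝ ℝ, volume] v

lemma contDiff_mollify {v : EuclideanSpace ℝ (Fin n) → ℝ} (hv : LocallyIntegrable v) :
    ContDiff ℝ (⊤ : ℕ∞) (mollify v) :=
  (halfBump n).hasCompactSupport_normed.contDiff_convolution_left _
    (halfBump n).contDiff_normed hv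

lemma mollify_sub_const {v : EuclideanSpace ℝ (Fin n) → ℝ} (hv : LocallyIntegrable v) (c : ℝ) :
    mollify (fun y => v y - c) = fun x => mollify v x - c := by
  ext x
  have h1 : ConvolutionExistsAt ((halfBump n).normed volume) v x
      (ContinuousLinearMap.lsmul ℝ ℝ) volume :=
    (halfBump n).hasCompactSupport_normed.convolutionExists_left _
      (halfBump n).continuous_normed hv x
  simp only [mollify, convolution, ContinuousLinearMap.lsmul_apply, smul_eq_mul, mul_sub]
  rw [integral_sub (by simpa [ConvolutionExistsAt] using h1)
    ((halfBump n).integrable_normed.mul_const c), integral_mul_const,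
    (halfBump n).integral_normed, one_mul]

lemma exists_norm_iteratedFDeriv_two_mollify_le (n : ℕ) :
    ∃ C : ℝ, 0 < C ∧ ∀ (v : EuclideanSpace ℝ (Fin n) → ℝ) (x : EuclideanSpace ℝ (Fin n)) (ε : ℝ),
      LocallyIntegrable v → 0 ≤ ε → (∀ y ∈ Metric.closedBall x (1 / 2), |v y - v x| ≤ ε) →
      ‖iteratedFDeriv ℝ 2 (mollify v) x‖ ≤ C * ε := by
  obtain ⟨C, hC, H⟩ := exists_norm_iteratedFDeriv_two_convolution_le
    (volume : Measure (EuclideanSpace ℝ (Fin n))) (η := (halfBump n).normed volume)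
    (halfBump n).hasCompactSupport_normed (halfBump n).contDiff_normed
  refine ⟨C, hC, fun v x ε hv hε hosc => ?_⟩
  have key := H (fun y => v y - v x) x ε (hv.sub (locallyIntegrable_const _)) hε fun t ht =>
    hosc (x - t) (by
      rw [(halfBump n).tsupport_normed_eq] at ht
      simpa [dist_eq_norm, halfBump] using ht)
  have hm := mollify_sub_const hv (v x)
  rw [mollify] at hm
  rw [hm, ← norm_iteratedFDeriv_fderiv] at key
  rw [← norm_iteratedFDeriv_fderiv]
  have hd : fderiv ℝ (fun z => mollify v z - v x) = fderiv ℝ (mollify v) :=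
    funext fun z => fderiv_sub_const _
  rwa [hd] at key

lemma abs_mollify_sub_le {v : EuclideanSpace ℝ (Fin n) → ℝ} (hv : Measurable v) {ε : ℝ}
    {x : EuclideanSpace ℝ (Fin n)} (h : ∀ y ∈ Metric.closedBall x (1 / 2), |v y - v x| ≤ ε) :
    |mollify v x - v x| ≤ ε :=
  (halfBump n).dist_normed_convolution_le hv.aestronglyMeasurable fun y hy =>
    h y (Metric.ball_subset_closedBall hy)

lemma mollify_eq {v : EuclideanSpace ℝ (Fin n) → ℝ} {x : EuclideanSpace ℝ (Fin n)}
    (h : ∀ y ∈ Metric.ball x (1 / 2), v y = v x) : mollify v x = v x :=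
  (halfBump n).normed_convolution_eq_right h

end Mollification

/-- Proposition on the lifting function: Let `n ≥ 1`, `s ∈ (0,1)`,
`α ∈ (0, 2s)`. There exist constants `C₀, C₁, C₂ > 0` depending only on `n, s, α` such
that for all `h, d, l > 0` and every `Λ : ℤⁿ → ℝ` with
`|Λ(a) − Λ(b)| ≤ 2h ‖a − b‖₁^α`, there is a smooth `u : ℝⁿ → ℝ` with
(i) `u = Λ(a)` on `Q̂_a := ∏ᵢ [aᵢ(l+d) − l/2, aᵢ(l+d) + l/2]`,
(ii) `‖D²u‖_∞ ≤ C₀ h/d²`, and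
(iii) `∫_{ℝⁿ} |u(x+y) + u(x−y) − 2u(x)|/|y|^(n+2s) dy ≤ C₁ (d+l)^(2−2s) h/d² + C₂ h/(d+l)^(2s)`
for every `x`. -/
theorem lifting_function_exists (n : ℕ) (hn : 1 ≤ n) (s α : ℝ)
    (hs : s ∈ Set.Ioo (0:ℝ) 1) (hα : α ∈ Set.Ioo (0:ℝ) (2 * s)) :
    ∃ C₀ C₁ C₂ : ℝ, 0 < C₀ ∧ 0 < C₁ ∧ 0 < C₂ ∧
      ∀ h d l : ℝ, 0 < h → 0 < d → 0 < l →
        ∀ Λ : (Fin n → ℤ) → ℝ,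
          (∀ a b : Fin n → ℤ,
              |Λ a - Λ b| ≤ 2 * h * ((∑ i, |(a i : ℝ) - (b i : ℝ)|) ^ α)) →
          ∃ u : EuclideanSpace ℝ (Fin n) → ℝ,
            ContDiff ℝ (⊤ : ℕ∞) u ∧
            (∀ (a : Fin n → ℤ) (x : EuclideanSpace ℝ (Fin n)),
                (∀ i, x i ∈ Set.Icc ((a i : ℝ) * (l + d) - l / 2)
                    ((a i : ℝ) * (l + d) + l / 2)) →
                u x = Λ a) ∧
            (∀ x : EuclideanSpace ℝ (Fin n),
                ‖iteratedFDeriv ℝ 2 u x‖ ≤ C₀ * h / d ^ 2) ∧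
            (∀ x : EuclideanSpace ℝ (Fin n),
                (∫ y : EuclideanSpace ℝ (Fin n),
                    |u (x + y) + u (x - y) - 2 * u x| / ‖y‖ ^ ((n : ℝ) + 2 * s))
                  ≤ C₁ * (d + l) ^ (2 - 2 * s) * h / d ^ 2 + C₂ * h / (d + l) ^ (2 * s)) := by
  obtain ⟨hα0, hα2⟩ := hα
  obtain ⟨C, hC, hess⟩ := exists_norm_iteratedFDeriv_two_mollify_le n
  set I₁ := ∫ z : EuclideanSpace ℝ (Fin n),
    (Set.Iic 1).indicator (fun t : ℝ => t ^ (2 - (n + 2 * s))) ‖z‖ with hI₁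
  set I₂ := ∫ z : EuclideanSpace ℝ (Fin n),
    (Set.Ioi 1).indicator (fun t : ℝ => t ^ (α - (n + 2 * s))) ‖z‖ with hI₂
  have hI₁0 : 0 ≤ I₁ := integral_nonneg fun z =>
    Set.indicator_apply_nonneg fun _ => Real.rpow_nonneg (norm_nonneg _) _
  have hI₂0 : 0 ≤ I₂ := integral_nonneg fun z =>
    Set.indicator_apply_nonneg fun _ => Real.rpow_nonneg (norm_nonneg _) _
  set A : ℝ := (2 * n) ^ α with hA
  have hA0 : 0 < A := by positivity
  refine ⟨C * (2 * A), C * (2 * A) * I₁ + 1, 12 * A * I₂ + 1, by positivity, by positivity,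
    by positivity, ?_⟩
  intro h d l hh hd hl Λ hΛ
  set L := d + l with hL
  have hL0 : 0 < L := by positivity
  have hr0 : 0 ≤ d / L := by positivity
  have hr1 : d / L ≤ 1 := by rw [div_le_one hL0]; linarith
  set v := latticeStep (d / L) Λ with hv
  have hvm : Measurable v := measurable_latticeStep _ _
  have hvi : LocallyIntegrable v := locallyIntegrable_latticeStep hr0 hh.le hα0.le hΛ
  have hgrowth : ∀ {p q : EuclideanSpace ℝ (Fin n)} {ρ : ℝ}, 1 ≤ ρ → d / L * ‖p - q‖ ≤ ρ →
      |v p - v q| ≤ 2 * h * A * ρ ^ α := fun hρ hpq =>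
    abs_latticeStep_sub_le_of_mul_norm_le hr0 hh.le hα0.le hΛ hρ hpq
  have hosc : ∀ x, ∀ y ∈ Metric.closedBall x (1 / 2), |v y - v x| ≤ 2 * h * A := by
    intro x y hy
    rw [mem_closedBall_iff_norm] at hy
    simpa using hgrowth (p := y) (q := x) le_rfl (by nlinarith [norm_nonneg (y - x)])
  have h2top : (2 : WithTop ℕ∞) ≤ ((⊤ : ℕ∞) : WithTop ℕ∞) :=
    WithTop.coe_le_coe.2 (le_top : (2 : ℕ∞) ≤ ⊤)
  have hsmooth : ContDiff ℝ (⊤ : ℕ∞) (mollify v) := contDiff_mollify hvi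
  have hu : ContDiff ℝ (⊤ : ℕ∞) fun x => mollify v (d⁻¹ • x) :=
    hsmooth.comp (contDiff_const_smul _)
  have hD2 : ∀ x, ‖iteratedFDeriv ℝ 2 (fun x => mollify v (d⁻¹ • x)) x‖ ≤
      C * (2 * A) * h / d ^ 2 := by
    intro x
    rw [iteratedFDeriv_comp_const_smul _ (hsmooth.of_le h2top), norm_smul,
      norm_pow, norm_inv, Real.norm_of_nonneg hd.le]
    calc _ ≤ d⁻¹ ^ 2 * (C * (2 * h * A)) := by
          gcongr
          exact hess v _ _ hvi (by positivity) (hosc _)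
      _ = _ := by field_simp
  refine ⟨fun x => mollify v (d⁻¹ • x), hu, ?_, hD2, ?_⟩
  · intro a x hx
    have hball : ∀ y ∈ Metric.ball (d⁻¹ • x) (1 / 2), v y = Λ a := by
      intro y hy
      refine latticeStep_eq fun i => ?_
      rw [mem_ball_iff_norm] at hy
      have hyi : |y i - d⁻¹ * x i| < 1 / 2 := (PiLp.norm_apply_le (y - d⁻¹ • x) i).trans_lt hy
      have hxi : |x i - a i * L| ≤ l / 2 := by
        obtain ⟨h1, h2⟩ := hx i
        rw [add_comm l d] at h1 h2
        rw [abs_le]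
        constructor <;> linarith
      have hsplit : d / L * y i - a i = (d * (y i - d⁻¹ * x i) + (x i - a i * L)) / L := by
        field_simp
        ring
      rw [hsplit, abs_div, abs_of_pos hL0, div_lt_iff₀ hL0]
      calc _ ≤ |d * (y i - d⁻¹ * x i)| + |x i - a i * L| := abs_add_le _ _
        _ < d * (1 / 2) + l / 2 := by
            rw [abs_mul, abs_of_pos hd]
            exact add_lt_add_of_lt_of_le (mul_lt_mul_of_pos_left hyi hd) hxi
        _ = 1 / 2 * L := by rw [hL]; ring
    have hcenter := hball _ (Metric.mem_ball_self (by norm_num))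
    exact (mollify_eq fun y hy => (hball y hy).trans hcenter.symm).trans hcenter
  · intro x
    set u : EuclideanSpace ℝ (Fin n) → ℝ := fun x => mollify v (d⁻¹ • x) with hu_def
    have hclose : ∀ x, |u x - v (d⁻¹ • x)| ≤ 2 * h * A := fun x =>
      abs_mollify_sub_le hvm (hosc _)
    have hincr : ∀ z w : EuclideanSpace ℝ (Fin n), L ≤ ‖w - z‖ →
        |u w - u z| ≤ 6 * h * A * (‖w - z‖ / L) ^ α := by
      intro z w hzw
      have hρ : 1 ≤ ‖w - z‖ / L := by rwa [one_le_div hL0]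
      have hρα : 1 ≤ (‖w - z‖ / L) ^ α := Real.one_le_rpow hρ hα0.le
      have hmid := hgrowth (p := d⁻¹ • w) (q := d⁻¹ • z) hρ (by
        rw [← smul_sub, norm_smul, norm_inv, Real.norm_of_nonneg hd.le]
        exact le_of_eq (by field_simp))
      have hone : 2 * h * A ≤ 2 * h * A * (‖w - z‖ / L) ^ α :=
        le_mul_of_one_le_right (by positivity) hρα
      have h1 := abs_le.1 (hclose w)
      have h2 := abs_le.1 (hclose z)
      have h3 := abs_le.1 hmid
      rw [abs_le]
      constructor <;> linarith
    have key := integral_div_norm_rpow_le hn hs.2 hα2 hL0 (K := C * (2 * A) * h / d ^ 2)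
      (M := 12 * h * A) (by positivity) (by positivity)
      (F := fun y => |u (x + y) + u (x - y) - 2 * u x|) (fun y => abs_nonneg _)
      (abs_second_difference_le (hu.of_le h2top) hD2 x)
      (fun y hy => by
        have h1 := hincr x (x + y) (by simpa using hy)
        have h2 := hincr x (x - y) (by simpa using hy)
        rw [add_sub_cancel_left] at h1
        rw [sub_sub_cancel_left, norm_neg] at h2
        calc |u (x + y) + u (x - y) - 2 * u x|
            = |(u (x + y) - u x) + (u (x - y) - u x)| := by ring_nf
          _ ≤ _ := abs_add_le _ _
          _ ≤ _ := add_le_add h1 h2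
          _ = _ := by ring)
    refine key.trans ?_
    rw [← hI₁, ← hI₂]
    have e1 : (C * (2 * A) * I₁ + 1) * L ^ (2 - 2 * s) * h / d ^ 2 =
        C * (2 * A) * h / d ^ 2 * L ^ (2 - 2 * s) * I₁ + L ^ (2 - 2 * s) * h / d ^ 2 := by ring
    have e2 : (12 * A * I₂ + 1) * h / L ^ (2 * s) =
        12 * h * A / L ^ (2 * s) * I₂ + h / L ^ (2 * s) := by ring
    rw [e1, e2]
    have p1 : 0 < L ^ (2 - 2 * s) * h / d ^ 2 := by positivity
    have p2 : 0 < h / L ^ (2 * s) := by positivity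
    linarith
end
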